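/- Let p be an odd prime with p not dividing n, and assume it is not the case that p = 3 and n = 5. Then for every maximal ideal 𝔭 of O lying over p and every integer d ≥ 1, the reduction map mod 𝔭^d sends Δ onto all of SL₂(O/𝔭^d). -/

import Mathlib

open Matrix
open scoped MatrixGroups

set_option synthInstance.maxHeartbeats 1000000
set_option maxHeartbeats 1000000

noncomputable section

/-- The ring `O = ℤ[ζ + ζ⁻¹]`, realized as a subalgebra of `ℂ`. -/
abbrev Oring (ζ : ℂ) : Subalgebra ℤ ℂ := Algebra.adjoin ℤ {ζ + ζ⁻¹}

/-- The element `ζ + ζ⁻¹` of `O`. -/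
def lamO (ζ : ℂ) : Oring ζ := ⟨ζ + ζ⁻¹, Algebra.subset_adjoin rfl⟩

/-- The matrix `T = [[1, 2 + ζ + ζ⁻¹], [0, 1]]` in `SL₂(O)`. -/
def Tmat (ζ : ℂ) : SL(2, Oring ζ) :=
  ⟨!![1, 2 + lamO ζ; 0, 1], by rw [Matrix.det_fin_two_of]; ring⟩

/-- The matrix `U = [[-1, 0], [1, -1]]` in `SL₂(O)`. -/
def Umat (ζ : ℂ) : SL(2, Oring ζ) :=
  ⟨!![-1, 0; 1, -1], by rw [Matrix.det_fin_two_of]; ring⟩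

/-- The matrix `R = U * T` in `SL₂(O)`. -/
def Rmat (ζ : ℂ) : SL(2, Oring ζ) := Umat ζ * Tmat ζ

/-- The triangle group `Δ = ⟨T, U⟩ ⊆ SL₂(O)`. -/
def Delta (ζ : ℂ) : Subgroup SL(2, Oring ζ) := Subgroup.closure {Tmat ζ, Umat ζ}

/-- Reduction mod the ideal `J`: the natural map `SL₂(O) → SL₂(O/J)`. -/
def SLred (ζ : ℂ) (J : Ideal (Oring ζ)) : SL(2, Oring ζ) →* SL(2, Oring ζ ⧸ J) :=
  Matrix.SpecialLinearGroup.map (Ideal.Quotient.mk J)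


section abstractgroup
variable {G : Type*} [Group G]

/-- elements conjugate into the centralizer of x, outside Z -/
def clsS (Z : Subgroup G) (x : G) : Set G :=
  {y | y ∉ Z ∧ ∃ g : G, Commute (g * y * g⁻¹) x}

/-- commuting conjugates of x -/
def conjC (x : G) : Set G := {y | Commute y x ∧ ∃ g : G, y = g * x * g⁻¹}

lemma fiber_count {α β : Type*} (f : α → β) (s : Set α) (t : Set β) [Finite α] [Finite β]
    (n : ℕ) (hf : ∀ a ∈ s, f a ∈ t) (h : ∀ b ∈ t, Nat.card {a | a ∈ s ∧ f a = b} = n) :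
    Nat.card s = Nat.card t * n := by
  classical
  have := Fintype.ofFinite α
  have := Fintype.ofFinite β
  have h1 := Finset.card_eq_sum_card_fiberwise (f := f) (s := s.toFinset) (t := t.toFinset)
    (by intro a ha; simp at ha ⊢; exact hf a ha)
  rw [Nat.card_eq_card_toFinset, Nat.card_eq_card_toFinset, h1, Finset.sum_const_nat]
  intro b hb
  rw [← h b (by simpa using hb), Nat.card_eq_card_toFinset]
  congr 1
  ext a; simp

lemma comm_conj {x y : G} (g : G) (h : Commute x y) :
    Commute (g * x * g⁻¹) (g * y * g⁻¹) := by
  have h : x * y = y * x := h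
  show _ = _
  calc _ = g * (x * y) * g⁻¹ := by group
    _ = g * (y * x) * g⁻¹ := by rw [h]
    _ = _ := by group

variable {Z : Subgroup G}

/-- CT property -/
def CT (Z : Subgroup G) : Prop :=
  ∀ x y z : G, y ∉ Z → Commute x y → Commute y z → Commute x z

lemma conj_notin (hZ : ∀ z ∈ Z, ∀ g : G, Commute z g) {x : G} (hx : x ∉ Z) (g : G) :
    g * x * g⁻¹ ∉ Z := by
  intro h
  apply hx
  have h2 : g⁻¹ * (g * x * g⁻¹) * g = g * x * g⁻¹ := by
    have := hZ _ h g
    have : (g * x * g⁻¹) * g = g * (g * x * g⁻¹) := this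
    rw [mul_assoc, this]; group
  have h3 : g⁻¹ * (g * x * g⁻¹) * g = x := by group
  rw [← h3, h2]; exact h

lemma key_conj (hCT : CT Z) (hZ : ∀ z ∈ Z, ∀ g : G, Commute z g) {x a : G}
    (ha : a ∉ Z) (hxa : Commute a x) (h : G)
    (hh : Commute (h * a * h⁻¹) x) : Commute (h * x * h⁻¹) x :=
  hCT _ _ _ (conj_notin hZ ha h) (comm_conj h hxa.symm) hh

/-- the normalizer of centralizer -/
def normN (hCT : CT Z) (hZ : ∀ z ∈ Z, ∀ g : G, Commute z g) (x : G) (hx : x ∉ Z) : Subgroup G where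
  carrier := {h | Commute (h * x * h⁻¹) x}
  one_mem' := by simp
  mul_mem' := by
    intro a b ha hb
    have h1 := comm_conj a hb
    have := hCT _ _ _ (conj_notin hZ hx a) h1 ha
    simpa [mul_assoc] using this
  inv_mem' := by
    intro a ha
    have := comm_conj a⁻¹ ha
    have h2 : a⁻¹ * (a * x * a⁻¹) * a⁻¹⁻¹ = x := by group
    rw [h2] at this
    exact this.symm

lemma card_normN [Finite G] (hCT : CT Z) (hZ : ∀ z ∈ Z, ∀ g : G, Commute z g) (x : G) (hx : x ∉ Z) :
    Nat.card (normN hCT hZ x hx) = Nat.card (conjC x) * Nat.card {y : G | Commute y x} := by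
  refine fiber_count (fun h : G => h * x * h⁻¹) (normN hCT hZ x hx : Set G) (conjC x) _ ?_ ?_
  · intro a ha; exact ⟨ha, a, rfl⟩
  · rintro b ⟨hb, g, rfl⟩
    refine Nat.card_congr (Equiv.subtypeEquiv (Equiv.mulLeft g⁻¹) ?_)
    intro a
    simp only [Set.mem_ofPred_eq, Equiv.coe_mulLeft]
    constructor
    · rintro ⟨_, h⟩
      show _ = _
      have : a * x = (g * x * g⁻¹) * a := by rw [← h]; group
      rw [mul_assoc, this]; group
    · intro h
      have h : g⁻¹ * a * x = x * (g⁻¹ * a) := h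
      have h2 : a * x * a⁻¹ = g * x * g⁻¹ := by
        have : a * x = g * x * g⁻¹ * a := by
          calc a * x = g * (g⁻¹ * a * x) := by group
            _ = _ := by rw [h]; group
        rw [this]; group
      refine ⟨?_, h2⟩
      show Commute _ _
      rw [h2]; exact hb

lemma card_cls [Finite G] (hCT : CT Z) (hZ : ∀ z ∈ Z, ∀ g : G, Commute z g) (x : G) (hx : x ∉ Z) :
    Nat.card (clsS Z x) * (Nat.card (conjC x) * Nat.card {y : G | Commute y x}) =
    (Nat.card {y : G | Commute y x} - Nat.card Z) * Nat.card G := by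
  rw [← card_normN hCT hZ x hx]
  rw [← fiber_count (fun w : G × G => w.1⁻¹ * w.2 * w.1) 
    {w : G × G | w.2 ∈ {y : G | Commute y x} \ (Z : Set G)} (clsS Z x)]
  · have : Nat.card {w : G × G | w.2 ∈ {y : G | Commute y x} \ (Z : Set G)} 
      = Nat.card (((Set.univ : Set G) ×ˢ ({y : G | Commute y x} \ (Z : Set G)) : Set (G × G))) := by
      congr 2; ext w; simp
    rw [this, Nat.card_coe_set_eq, Set.ncard_prod, mul_comm, Set.ncard_univ, Set.ncard_sdiff]
    · rfl
    · intro z hz; exact hZ z hz x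
  · rintro ⟨g, a⟩ ⟨h1, h2⟩
    refine ⟨?_, g, ?_⟩
    · have := conj_notin hZ h2 g⁻¹; simpa using this
    · have : g * (g⁻¹ * a * g) * g⁻¹ = a := by group
      rw [this]; exact h1
  · rintro y ⟨hy, g0, hg0⟩
    have ha0 := conj_notin hZ hy g0
    refine (Nat.card_congr (Equiv.ofBijective (fun h : normN hCT hZ x hx => 
      (⟨((h : G) * g0, ((h : G) * g0) * y * (h * g0)⁻¹), ?_, ?_⟩ : 
       {a : G × G | a ∈ {w : G × G | w.2 ∈ {y : G | Commute y x} \ (Z : Set G)} ∧ a.1⁻¹ * a.2 * a.1 = y})) ⟨?_, ?_⟩)).symm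
    · refine ⟨?_, ?_⟩
      · have h1 : Commute ((h:G) * x * (h:G)⁻¹) x := h.2
        have := hCT _ _ _ (conj_notin hZ hx h) (comm_conj (h:G) hg0) h1
        simp only [Set.mem_ofPred_eq]
        convert this using 1
        group
      · exact conj_notin hZ hy _
    · simp only; group
    · intro h h' hh
      simp at hh
      exact hh.1
    · rintro ⟨⟨g, a⟩, ⟨h1, h2⟩, h3⟩
      simp only at h1 h2 h3
      refine ⟨⟨g * g0⁻¹, ?_⟩, ?_⟩
      · refine key_conj hCT hZ ha0 hg0 (g * g0⁻¹) ?_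
        have : g * g0⁻¹ * (g0 * y * g0⁻¹) * (g * g0⁻¹)⁻¹ = a := by rw [← h3]; group
        rw [this]; exact h1
      · apply Subtype.ext
        simp only [Prod.mk.injEq]
        refine ⟨by group, by rw [← h3]; group⟩

lemma cls_disjoint (hCT : CT Z) (hZ : ∀ z ∈ Z, ∀ g : G, Commute z g) {x x' : G} (hx' : x' ∉ Z)
    (h : x' ∉ clsS Z x) : Disjoint (clsS Z x) (clsS Z x') := by
  rw [Set.disjoint_left]
  rintro y ⟨hy, g, hg⟩ ⟨_, g', hg'⟩
  apply h
  refine ⟨hx', g * g'⁻¹, ?_⟩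
  have h1 := comm_conj (g * g'⁻¹) hg'
  have h2 : g * g'⁻¹ * (g' * y * g'⁻¹) * (g * g'⁻¹)⁻¹ = g * y * g⁻¹ := by group
  rw [h2] at h1
  exact hCT _ _ _ (conj_notin hZ hy g) h1.symm hg

lemma self_mem_cls {x : G} (hx : x ∉ Z) : x ∈ clsS Z x := ⟨hx, 1, by simp⟩

end abstractgroup

section counting
set_option linter.unusedSectionVars false
set_option maxHeartbeats 1000000
lemma ns_bound {S f w N : ℕ} (hf : f = 1 ∨ f = 2) (hw : 2 ≤ w)
    (h : S * (f * (2 * w)) = (2 * w - 2) * (2 * N)) :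
    S * f * w + 2 * N = w * (2 * N) ∧ N ≤ 2 * S ∧ (f = 1 → N ≤ S) := by
  obtain ⟨v, rfl⟩ : ∃ v, w = v + 2 := ⟨w - 2, by omega⟩
  have e : 2 * (v + 2) - 2 = 2 * (v + 1) := by omega
  rw [e] at h
  have h1 : S * f * (v + 2) + 2 * N = (v + 2) * (2 * N) := by nlinarith
  refine ⟨h1, ?_, ?_⟩
  · by_contra hc
    push Not at hc
    rcases hf with rfl | rfl <;> nlinarith [Nat.zero_le (v * N), Nat.zero_le (v * S)]
  · rintro rfl
    by_contra hc
    push Not at hc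
    nlinarith [Nat.zero_le (v * N), Nat.zero_le (v * S)]

lemma arith_final {q c M w : ℕ} (hq : 3 ≤ q) (hqodd : Odd q) (hc1 : 1 ≤ c) (hc : c + 1 ≤ q) (hM : 2 ≤ M)
    (hw : Nat.Coprime w q) (h : w * (2 + (q - 2) * M) = q * c * M) :
    M = q + 1 ∨ (q = 3 ∧ c = 2 ∧ w = 5) := by
  have h1 : q ∣ (2 + (q - 2) * M) := by
    apply Nat.Coprime.dvd_of_dvd_mul_left hw.symm
    rw [h, mul_assoc]; exact dvd_mul_right _ _
  have h2 : q ∣ 2 * (M - 1) := by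
    have e : 2 + (q - 2) * M + 2 * (M - 1) = q * M := by
      obtain ⟨r, rfl⟩ : ∃ r, q = r + 2 := ⟨q - 2, by omega⟩
      obtain ⟨m, rfl⟩ : ∃ m, M = m + 1 := ⟨M - 1, by omega⟩
      simp; ring
    exact (Nat.dvd_add_right h1).1 (e ▸ dvd_mul_right _ _)
  have h3 : q ∣ M - 1 := by
    apply Nat.Coprime.dvd_of_dvd_mul_left _ h2
    exact (Nat.coprime_two_right.2 hqodd)
  obtain ⟨k, hk⟩ := h3
  have hM' : M = 1 + k * q := by rw [mul_comm]; omega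
  have hk0 : 1 ≤ k := by
    rcases Nat.eq_zero_or_pos k with rfl | h
    · omega
    · exact h
  obtain ⟨r, rfl⟩ : ∃ r, q = r + 2 := ⟨q - 2, by omega⟩
  have hD : w * (1 + k * r) = c * (1 + k * (r + 2)) := by
    have : (r + 2) * (w * (1 + k * r)) = (r + 2) * (c * (1 + k * (r + 2))) := by
      rw [hM'] at h
      simp at h
      nlinarith
    exact Nat.eq_of_mul_eq_mul_left (by omega) this
  have hdvd : (1 + k * r) ∣ c * 2 := by
    have a1 : (1 + k * r) ∣ c * (1 + k * r) + (c * 2) * k := by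
      have : c * (1 + k * r) + (c * 2) * k = w * (1 + k * r) := by rw [hD]; ring
      rw [this]; exact dvd_mul_left _ _
    have a2 : (1 + k * r) ∣ (c * 2) * k := (Nat.dvd_add_right (dvd_mul_left _ _)).1 a1
    refine Nat.Coprime.dvd_of_dvd_mul_right ?_ a2
    simp [Nat.coprime_comm]
  obtain ⟨e, he⟩ := hdvd
  have he1 : 1 ≤ e := by
    rcases Nat.eq_zero_or_pos e with rfl | h
    · omega
    · exact h
  have hk3 : k ≤ 3 := by
    by_contra hh
    push Not at hh
    have : 1 + 4 * r ≤ 1 + k * r := by nlinarith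
    nlinarith
  interval_cases k
  · left; rw [hM']; ring
  · exfalso
    have : e = 1 := by
      by_contra hne
      have : 2 ≤ e := by omega
      nlinarith
    subst this
    omega
  · right
    have : e = 1 := by
      by_contra hne
      have : 2 ≤ e := by omega
      nlinarith
    subst this
    have hr : r = 1 := by omega
    subst hr
    have : c = 2 := by omega
    subst this
    refine ⟨rfl, rfl, by omega⟩

variable {G : Type*} [Group G] [Finite G] {Z : Subgroup G}

lemma card_disj3 {A B C D : Set G} (h1 : Disjoint A B) (h2 : Disjoint A C) (h3 : Disjoint B C)
   (hD1 : Disjoint A D) (hD2 : Disjoint B D) (hD3 : Disjoint C D) :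
   Nat.card A + Nat.card B + Nat.card C + Nat.card D ≤ Nat.card G := by
  simp only [Nat.card_coe_set_eq]
  rw [← Set.ncard_union_eq h1 , ← Set.ncard_union_eq (by simp [*]) , ← Set.ncard_union_eq (by simp [*]) ]
  exact Set.ncard_le_card _

lemma pow_of_cls {x t : G} {m : ℕ} (hm : Nat.card {y : G | Commute y t} = m) (hx : x ∈ clsS Z t) : x ^ m = 1 := by
  obtain ⟨_, g, hg⟩ := hx
  have h1 : Nat.card (Subgroup.centralizer {t}) = m := by
    rw [← hm]
    apply Nat.card_congr
    apply Equiv.subtypeEquivRight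
    intro a
    rw [Subgroup.mem_centralizer_singleton_iff]
    rfl
  have h2 : (⟨g * x * g⁻¹, by rw [Subgroup.mem_centralizer_singleton_iff]; exact hg⟩ : Subgroup.centralizer {t}) ^ m = 1 := by
    rw [← h1]; exact pow_card_eq_one'
  have h3 : (g * x * g⁻¹) ^ m = 1 := congrArg Subtype.val h2
  rw [conj_pow] at h3
  simpa using h3

lemma exists_notin {A B C : Set G} (h : Nat.card A + Nat.card B + Nat.card C < Nat.card G) :
    ∃ x, x ∉ A ∧ x ∉ B ∧ x ∉ C := by
  by_contra hc
  push Not at hc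
  have : (A ∪ B) ∪ C = Set.univ := by
    ext x
    have := hc x
    simp only [Set.mem_union, Set.mem_univ, iff_true]; tauto
  have h2 := Set.ncard_union_le (A ∪ B) C
  have h3 := Set.ncard_union_le A B
  rw [this, Set.ncard_univ] at h2
  simp only [Nat.card_coe_set_eq] at h
  omega

theorem dickson_count (hCT : CT Z) (hZ : ∀ z ∈ Z, ∀ g : G, Commute z g) (hZ2 : Nat.card Z = 2)
   (u : G) (hu : u ∉ Z) (q c M : ℕ) (hq : 3 ≤ q) (hqodd : Odd q)
   (hcu : Nat.card {y : G | Commute y u} = 2 * q)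
   (hmu : Nat.card (conjC u) = c) (hc1 : 1 ≤ c) (hc : c + 1 ≤ q)
   (hG : Nat.card G = 2 * (q * c * M)) (hM : 2 ≤ M)
   (htor : 2 ≤ c → ∃ t, t ∉ Z ∧ t ∉ clsS Z u ∧ Nat.card {y : G | Commute y t} = 2 * c)
   (hoth : ∀ x, x ∉ Z → x ∉ clsS Z u → (Nat.card (conjC x) = 1 ∨ Nat.card (conjC x) = 2) ∧
     ∃ w, 2 ≤ w ∧ Nat.card {y : G | Commute y x} = 2 * w ∧ Nat.Coprime w q) :
   M = q + 1 ∨ (q = 3 ∧ ∀ x, x ∉ Z → x ∉ clsS Z u → x ^ 4 = 1 ∨ x ^ 10 = 1) := by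
  have hZd : ∀ x, Disjoint (Z : Set G) (clsS Z x) := by
    intro x
    rw [Set.disjoint_left]; rintro a ha ⟨h, _⟩; exact h ha
  have hZc : Nat.card (Z : Set G) = 2 := hZ2
  have hns : ∀ x, x ∉ Z → x ∉ clsS Z u → ∃ f w, (f = 1 ∨ f = 2) ∧ 2 ≤ w ∧ 
      Nat.card {y : G | Commute y x} = 2 * w ∧ Nat.Coprime w q ∧
      Nat.card (clsS Z x) * (f * (2 * w)) = (2 * w - 2) * (2 * (q * c * M)) := by
    intro x hx hxu
    obtain ⟨hf, w, hw, hw2, hw3⟩ := hoth x hx hxu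
    refine ⟨_, w, hf, hw, hw2, hw3, ?_⟩
    have := card_cls hCT hZ x hx
    rw [hw2, hZ2, hG] at this
    exact this
  have hS0 : Nat.card (clsS Z u) + 2 * M = 2 * q * M := by
    have := card_cls hCT hZ u hu
    rw [hcu, hZ2, hG, hmu] at this
    obtain ⟨r, rfl⟩ : ∃ r, q = r + 1 := ⟨q - 1, by omega⟩
    have e : 2 * (r + 1) - 2 = 2 * r := by omega
    rw [e] at this
    have : (c * (2 * (r + 1))) * Nat.card (clsS Z u) = (c * (2 * (r + 1))) * (2 * r * M) := by
      rw [mul_comm, this]; ring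
    have := Nat.eq_of_mul_eq_mul_left (by positivity) this
    rw [this]; ring
  have hT : ∃ T : Set G, Disjoint (Z : Set G) T ∧ Disjoint (clsS Z u) T ∧ Nat.card T + q * M = q * c * M ∧
      (∀ x, x ∉ Z → x ∉ clsS Z u → x ∉ T → Disjoint T (clsS Z x)) ∧ (∀ x ∈ T, x ^ (2 * c) = 1) := by
    by_cases hc2 : 2 ≤ c
    · obtain ⟨t, htZ, htu, htc⟩ := htor hc2
      refine ⟨clsS Z t, hZd t, cls_disjoint hCT hZ htZ htu, ?_, ?_, ?_⟩
      · obtain ⟨f, w, hf, hw, hw2, hw3, hw4⟩ := hns t htZ htu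
        have hwc : w = c := by omega
        subst hwc
        obtain ⟨b1, b2, b3⟩ := ns_bound hf hw hw4
        have b4 : Nat.card (clsS Z t) * f + 2 * (q * M) = 2 * (q * w * M) := by
          have : w * (Nat.card (clsS Z t) * f + 2 * (q * M)) = w * (2 * (q * w * M)) := by
            first | linarith | nlinarith
          exact Nat.eq_of_mul_eq_mul_left (by omega) this
        rcases hf with rfl | rfl
        · exfalso
          have hlow : 2 * 3 * M ≤ q * w * M := by
            apply Nat.mul_le_mul_right
            first | linarith | nlinarith
          obtain ⟨x, x1, x2, x3⟩ := exists_notin (A := (Z : Set G)) (B := clsS Z u) (C := clsS Z t) (by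
            rw [hZc, hG]; first | linarith | nlinarith)
          obtain ⟨f, v, hf, hv, hv2, hv3, hv4⟩ := hns x x1 x2
          obtain ⟨a1, a2, a3⟩ := ns_bound hf hv hv4
          have := card_disj3 (hZd u) (hZd t) (cls_disjoint hCT hZ htZ htu) (hZd x)
            (cls_disjoint hCT hZ x1 x2) (cls_disjoint hCT hZ x1 x3)
          rw [hZc, hG] at this
          first | linarith | nlinarith
        · first | linarith | nlinarith
      · intro x x1 x2 x3
        exact cls_disjoint hCT hZ x1 x3
      · intro x hx
        exact pow_of_cls htc hx
    · have : c = 1 := by omega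
      subst this
      refine ⟨∅, by simp, by simp, by simp, by simp, by simp⟩
  obtain ⟨T, T1, T2, T3, T4, T5⟩ := hT
  have hqcM : q * M ≤ q * c * M := by omega
  have hq3 : 3 * M ≤ q * M := Nat.mul_le_mul_right _ hq
  obtain ⟨x, x1, x2, x3⟩ := exists_notin (A := (Z : Set G)) (B := clsS Z u) (C := T) (by
    rw [hZc, hG]; first | linarith | nlinarith)
  obtain ⟨f, w, hf, hw, hw2, hw3, hw4⟩ := hns x x1 x2
  obtain ⟨a1, a2, a3⟩ := ns_bound hf hw hw4
  have hsum := card_disj3 (hZd u) T1 T2 (hZd x) (cls_disjoint hCT hZ x1 x2) (T4 x x1 x2 x3)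
  rw [hZc, hG] at hsum
  have hf2 : f = 2 := by
    rcases hf with rfl | rfl
    · exfalso
      have := a3 rfl
      first | linarith | nlinarith
    · rfl
  subst hf2
  have hall : ∀ y, y ∉ Z → y ∉ clsS Z u → y ∈ T ∨ y ∈ clsS Z x := by
    intro y y1 y2
    by_contra hc
    push Not at hc
    obtain ⟨y3, y4⟩ := hc
    obtain ⟨f', w', hf', hw', hw2', hw3', hw4'⟩ := hns y y1 y2
    obtain ⟨a1', a2', a3'⟩ := ns_bound hf' hw' hw4'
    have h4 := card_disj3 (A := (Z : Set G) ∪ clsS Z u) (B := T) (C := clsS Z x) (D := clsS Z y)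
      (by simp [*]) (by simp [hZd, cls_disjoint hCT hZ x1 x2]) (T4 x x1 x2 x3)
      (by simp [hZd, cls_disjoint hCT hZ y1 y2]) (T4 y y1 y2 y3) (cls_disjoint hCT hZ y1 y4)
    have h5 : Nat.card ((Z : Set G) ∪ clsS Z u : Set G) = 2 + Nat.card (clsS Z u) := by
      rw [← hZc]
      simp only [Nat.card_coe_set_eq]
      exact Set.ncard_union_eq (hZd u)
    rw [h5, hG] at h4
    first | linarith | nlinarith
  have htot : Nat.card G ≤ 2 + Nat.card (clsS Z u) + Nat.card T + Nat.card (clsS Z x) := by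
    have : (((Z : Set G) ∪ clsS Z u) ∪ T) ∪ clsS Z x = Set.univ := by
      ext y
      have := hall y
      simp only [Set.mem_union, Set.mem_univ, iff_true, SetLike.mem_coe]; tauto
    have e1 := Set.ncard_union_le (((Z : Set G) ∪ clsS Z u) ∪ T) (clsS Z x)
    have e2 := Set.ncard_union_le ((Z : Set G) ∪ clsS Z u) T
    have e3 := Set.ncard_union_le (Z : Set G) (clsS Z u) 
    rw [this, Set.ncard_univ] at e1
    simp only [Nat.card_coe_set_eq] at hZc ⊢
    omega
  rw [hG] at htot
  have heq : 2 + Nat.card (clsS Z u) + Nat.card T + Nat.card (clsS Z x) = 2 * (q * c * M) := by omega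
  have hfin : w * (2 + (q - 2) * M) = q * c * M := by
    obtain ⟨r, rfl⟩ : ∃ r, q = r + 2 := ⟨q - 2, by omega⟩
    simp only [Nat.add_sub_cancel]
    have k1 : Nat.card (clsS Z x) + (2 + r * M) = (r + 2) * c * M := by first | linarith | nlinarith
    first | linarith | nlinarith
  rcases arith_final hq hqodd hc1 hc hM hw3 hfin with h | ⟨h1, h2, h3⟩
  · left; exact h
  · right
    refine ⟨h1, ?_⟩
    intro y y1 y2
    rcases hall y y1 y2 with h | h
    · left
      have := T5 y h
      rwa [h2] at this
    · right
      apply pow_of_cls _ h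
      rw [hw2, h3]
end counting

section sl2basic
variable {R : Type*} [CommRing R]

def e12 (x : R) : SL(2, R) := ⟨!![1, x; 0, 1], by rw [Matrix.det_fin_two_of]; ring⟩
def e21 (x : R) : SL(2, R) := ⟨!![1, 0; x, 1], by rw [Matrix.det_fin_two_of]; ring⟩

lemma e12_00 (x : R) : (e12 x).1 0 0 = 1 := rfl
lemma e12_01 (x : R) : (e12 x).1 0 1 = x := rfl
lemma e12_10 (x : R) : (e12 x).1 1 0 = 0 := rfl
lemma e12_11 (x : R) : (e12 x).1 1 1 = 1 := rfl
lemma e21_00 (x : R) : (e21 x).1 0 0 = 1 := rfl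
lemma e21_01 (x : R) : (e21 x).1 0 1 = 0 := rfl
lemma e21_10 (x : R) : (e21 x).1 1 0 = x := rfl
lemma e21_11 (x : R) : (e21 x).1 1 1 = 1 := rfl
lemma sm00 (x y : SL(2, R)) : (x * y).1 0 0 = x.1 0 0 * y.1 0 0 + x.1 0 1 * y.1 1 0 := by
  simp [Matrix.mul_apply, Fin.sum_univ_two]
lemma sm01 (x y : SL(2, R)) : (x * y).1 0 1 = x.1 0 0 * y.1 0 1 + x.1 0 1 * y.1 1 1 := by
  simp [Matrix.mul_apply, Fin.sum_univ_two]
lemma sm10 (x y : SL(2, R)) : (x * y).1 1 0 = x.1 1 0 * y.1 0 0 + x.1 1 1 * y.1 1 0 := by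
  simp [Matrix.mul_apply, Fin.sum_univ_two]
lemma sm11 (x y : SL(2, R)) : (x * y).1 1 1 = x.1 1 0 * y.1 0 1 + x.1 1 1 * y.1 1 1 := by
  simp [Matrix.mul_apply, Fin.sum_univ_two]
lemma si00 (x : SL(2, R)) : (x⁻¹).1 0 0 = x.1 1 1 := by
  simp [Matrix.SpecialLinearGroup.coe_inv, Matrix.adjugate_fin_two]
lemma si01 (x : SL(2, R)) : (x⁻¹).1 0 1 = - x.1 0 1 := by
  simp [Matrix.SpecialLinearGroup.coe_inv, Matrix.adjugate_fin_two]
lemma si10 (x : SL(2, R)) : (x⁻¹).1 1 0 = - x.1 1 0 := by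
  simp [Matrix.SpecialLinearGroup.coe_inv, Matrix.adjugate_fin_two]
lemma si11 (x : SL(2, R)) : (x⁻¹).1 1 1 = x.1 0 0 := by
  simp [Matrix.SpecialLinearGroup.coe_inv, Matrix.adjugate_fin_two]
lemma so00 : (1 : SL(2, R)).1 0 0 = 1 := by simp
lemma so01 : (1 : SL(2, R)).1 0 1 = 0 := by simp
lemma so10 : (1 : SL(2, R)).1 1 0 = 0 := by simp
lemma so11 : (1 : SL(2, R)).1 1 1 = 1 := by simp
lemma sn00 (x : SL(2, R)) : (-x).1 0 0 = - x.1 0 0 := by simp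
lemma sn01 (x : SL(2, R)) : (-x).1 0 1 = - x.1 0 1 := by simp
lemma sn10 (x : SL(2, R)) : (-x).1 1 0 = - x.1 1 0 := by simp
lemma sn11 (x : SL(2, R)) : (-x).1 1 1 = - x.1 1 1 := by simp
lemma sdet (x : SL(2, R)) : x.1 0 0 * x.1 1 1 - x.1 0 1 * x.1 1 0 = 1 := by
  have := x.2; rwa [Matrix.det_fin_two] at this
lemma sext {x y : SL(2, R)} (h1 : x.1 0 0 = y.1 0 0) (h2 : x.1 0 1 = y.1 0 1) (h3 : x.1 1 0 = y.1 1 0)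
    (h4 : x.1 1 1 = y.1 1 1) : x = y := by
  apply Subtype.ext
  ext i j
  fin_cases i <;> fin_cases j <;> assumption

lemma e12_add (x y : R) : e12 (x + y) = e12 x * e12 y := by
  apply sext <;> simp only [sm00, sm01, sm10, sm11, e12_00, e12_01, e12_10, e12_11] <;> ring
lemma e21_add (x y : R) : e21 (x + y) = e21 x * e21 y := by
  apply sext <;> simp only [sm00, sm01, sm10, sm11, e21_00, e21_01, e21_10, e21_11] <;> ring
lemma e12_zero : e12 (0 : R) = 1 := by
  apply sext <;> simp only [so00, so01, so10, so11, e12_00, e12_01, e12_10, e12_11]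
lemma e21_zero : e21 (0 : R) = 1 := by
  apply sext <;> simp only [so00, so01, so10, so11, e21_00, e21_01, e21_10, e21_11]
lemma e12_neg (x : R) : e12 (-x) = (e12 x)⁻¹ := by
  apply sext <;> simp only [si00, si01, si10, si11, e12_00, e12_01, e12_10, e12_11] <;> ring
lemma e21_neg (x : R) : e21 (-x) = (e21 x)⁻¹ := by
  apply sext <;> simp only [si00, si01, si10, si11, e21_00, e21_01, e21_10, e21_11] <;> ring

lemma scomm_iff (x y : SL(2, R)) : Commute x y ↔ x.1 0 1 * y.1 1 0 = y.1 0 1 * x.1 1 0 ∧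
    x.1 0 1 * (y.1 0 0 - y.1 1 1) = y.1 0 1 * (x.1 0 0 - x.1 1 1) ∧
    x.1 1 0 * (y.1 0 0 - y.1 1 1) = y.1 1 0 * (x.1 0 0 - x.1 1 1) := by
  constructor
  · intro h
    have h : x * y = y * x := h
    have h1 := congrArg (fun z : SL(2, R) => z.1 0 0) h
    have h2 := congrArg (fun z : SL(2, R) => z.1 0 1) h
    have h3 := congrArg (fun z : SL(2, R) => z.1 1 0) h
    simp only [sm00, sm01, sm10] at h1 h2 h3
    refine ⟨by linear_combination h1, by linear_combination -h2, by linear_combination h3⟩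
  · rintro ⟨h1, h2, h3⟩
    apply sext <;> simp only [sm00, sm01, sm10, sm11]
    · linear_combination h1
    · linear_combination -h2
    · linear_combination h3
    · linear_combination -h1

/-- additive group of upper unipotents in H -/
def upX (H : Subgroup SL(2, R)) : AddSubgroup R where
  carrier := {x | e12 x ∈ H}
  zero_mem' := by show e12 0 ∈ H; rw [e12_zero]; exact H.one_mem
  add_mem' := by intro a b ha hb; show e12 _ ∈ H; rw [e12_add]; exact H.mul_mem ha hb
  neg_mem' := by intro a ha; show e12 _ ∈ H; rw [e12_neg]; exact H.inv_mem ha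

def loY (H : Subgroup SL(2, R)) : AddSubgroup R where
  carrier := {x | e21 x ∈ H}
  zero_mem' := by show e21 0 ∈ H; rw [e21_zero]; exact H.one_mem
  add_mem' := by intro a b ha hb; show e21 _ ∈ H; rw [e21_add]; exact H.mul_mem ha hb
  neg_mem' := by intro a ha; show e21 _ ∈ H; rw [e21_neg]; exact H.inv_mem ha

lemma sl2_gen [IsLocalRing R] (H : Subgroup SL(2, R)) (h1 : ∀ x, e12 x ∈ H) (h2 : ∀ x, e21 x ∈ H) : H = ⊤ := by
  have key : ∀ g : SL(2, R), IsUnit (g.1 1 0) → g ∈ H := by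
    intro g hg
    obtain ⟨c, hc⟩ := hg
    have hc' : g.1 1 0 * ↑c⁻¹ = 1 := by rw [← hc]; simp
    have : g = e12 ((g.1 0 0 - 1) * ↑c⁻¹) * e21 (g.1 1 0) * e12 ((g.1 1 1 - 1) * ↑c⁻¹) := by
      have hd := sdet g
      apply sext <;> simp only [sm00, sm01, sm10, sm11, e12_00, e12_01, e12_10, e12_11, e21_00, e21_01, e21_10, e21_11]
      · linear_combination (1 - g.1 0 0) * hc'
      · linear_combination (-(g.1 0 0 - 1) * (g.1 1 1 - 1) * (c⁻¹ : Rˣ) - g.1 0 1) * hc' - (c⁻¹ : Rˣ) * hd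
      · ring
      · linear_combination (1 - g.1 1 1) * hc'
    rw [this]
    exact H.mul_mem (H.mul_mem (h1 _) (h2 _)) (h1 _)
  rw [eq_top_iff]
  intro g _
  by_cases hc : IsUnit (g.1 1 0)
  · exact key g hc
  have ha : IsUnit (g.1 0 0) := by
    rcases IsLocalRing.isUnit_or_isUnit_of_isUnit_add (a := g.1 0 0 * g.1 1 1) (b := - (g.1 0 1 * g.1 1 0))
      (by rw [← sub_eq_add_neg, sdet]; exact isUnit_one) with h | h
    · exact isUnit_of_mul_isUnit_left h
    · exact absurd (isUnit_of_mul_isUnit_right ((IsUnit.neg_iff _).1 h)) hc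
  have h3 : e21 1 * g ∈ H := by
    apply key
    rw [sm10, e21_10, e21_11]
    rcases IsLocalRing.isUnit_or_isUnit_of_isUnit_add (a := 1 * g.1 0 0 + 1 * g.1 1 0) (b := - g.1 1 0)
      (by ring_nf; exact ha) with h | h
    · exact h
    · exact absurd ((IsUnit.neg_iff _).1 h) hc
  exact (Subgroup.mul_mem_cancel_left H (h2 1)).1 h3
end sl2basic

section sl2field
set_option linter.unusedSectionVars false
set_option linter.unnecessarySeqFocus false
set_option maxHeartbeats 1000000
variable {F : Type*} [Field F]

def str (x : SL(2, F)) : F := x.1 0 0 + x.1 1 1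

lemma str_conj (g x : SL(2, F)) : str (g * x * g⁻¹) = str x := by
  unfold str
  simp only [sm00, sm01, sm10, sm11, si00, si01, si10, si11]
  linear_combination (x.1 0 0 + x.1 1 1) * sdet g

def ZH (H : Subgroup SL(2, F)) : Subgroup H where
  carrier := {h | h.1.1 0 1 = 0 ∧ h.1.1 1 0 = 0 ∧ h.1.1 0 0 = h.1.1 1 1}
  one_mem' := by simp
  mul_mem' := by
    rintro ⟨a, _⟩ ⟨b, _⟩ ⟨h1, h2, h3⟩ ⟨h4, h5, h6⟩
    simp only at h1 h2 h3 h4 h5 h6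
    show (a * b).1 0 1 = 0 ∧ (a * b).1 1 0 = 0 ∧ (a * b).1 0 0 = (a * b).1 1 1
    simp [sm00, sm01, sm10, sm11, h1, h2, h3, h4, h5, h6]
  inv_mem' := by
    rintro ⟨a, _⟩ ⟨h1, h2, h3⟩
    simp only at h1 h2 h3
    show (a⁻¹).1 0 1 = 0 ∧ (a⁻¹).1 1 0 = 0 ∧ (a⁻¹).1 0 0 = (a⁻¹).1 1 1
    simp only [si00, si01, si10, si11, h1, h2, h3]; simp

lemma mem_ZH {H : Subgroup SL(2, F)} (h : H) : h ∈ ZH H ↔ h.1.1 0 1 = 0 ∧ h.1.1 1 0 = 0 ∧ h.1.1 0 0 = h.1.1 1 1 := Iff.rfl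

lemma comm_sub {H : Subgroup SL(2, F)} (x y : H) : Commute x y ↔ Commute x.1 y.1 := by
  constructor
  · intro h; exact congrArg Subtype.val h.eq
  · intro h; exact Subtype.ext h.eq

lemma ZH_central {H : Subgroup SL(2, F)} : ∀ z ∈ ZH H, ∀ g : H, Commute z g := by
  rintro z ⟨h1, h2, h3⟩ g
  rw [comm_sub, scomm_iff]
  simp [h1, h2, h3]

lemma ZH_CT {H : Subgroup SL(2, F)} : CT (ZH H) := by
  intro x y z hy h1 h2
  rw [comm_sub, scomm_iff] at *
  rw [mem_ZH] at hy
  obtain ⟨a1, a2, a3⟩ := h1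
  obtain ⟨b1, b2, b3⟩ := h2
  generalize x.1.1 0 0 - x.1.1 1 1 = x0 at *
  generalize z.1.1 0 0 - z.1.1 1 1 = z0 at *
  have e : y.1.1 0 0 = y.1.1 1 1 ↔ y.1.1 0 0 - y.1.1 1 1 = 0 := sub_eq_zero.symm
  rw [e] at hy
  generalize y.1.1 0 0 - y.1.1 1 1 = y0 at *
  generalize x.1.1 0 1 = x1 at *
  generalize x.1.1 1 0 = x2 at *
  generalize y.1.1 0 1 = y1 at *
  generalize y.1.1 1 0 = y2 at *
  generalize z.1.1 0 1 = z1 at *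
  generalize z.1.1 1 0 = z2 at *
  clear e
  by_cases h1 : y1 = 0
  · by_cases h2 : y2 = 0
    · have h0 : y0 ≠ 0 := fun h => hy ⟨h1, h2, h⟩
      subst h1 h2
      have : x1 = 0 := by simpa [h0] using a2
      have : x2 = 0 := by simpa [h0] using a3
      have : z1 = 0 := by simpa [h0] using b2.symm
      have : z2 = 0 := by simpa [h0] using b3.symm
      simp [*]
    · refine ⟨mul_left_cancel₀ h2 ?_, mul_left_cancel₀ h2 ?_, mul_left_cancel₀ h2 ?_⟩ <;> grind
  · refine ⟨mul_left_cancel₀ h1 ?_, mul_left_cancel₀ h1 ?_, mul_left_cancel₀ h1 ?_⟩ <;> grind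

lemma scalar_pm {x : SL(2, F)} (h1 : x.1 0 1 = 0) (h2 : x.1 1 0 = 0) (h3 : x.1 0 0 = x.1 1 1) : x = 1 ∨ x = -1 := by
  have hd := sdet x
  rw [h1, h3] at hd
  have : (x.1 1 1 - 1) * (x.1 1 1 + 1) = 0 := by linear_combination hd
  rcases mul_eq_zero.1 this with h | h
  · left
    apply sext <;> simp only [so00, so01, so10, so11, h1, h2, h3] <;> linear_combination h
  · right
    apply sext <;> simp only [sn00, sn01, sn10, sn11, so00, so01, so10, so11, h1, h2, h3] <;> first | linear_combination h | simp


lemma ZH_card {H : Subgroup SL(2, F)} (hneg : (-1 : SL(2, F)) ∈ H) (h2F : (2 : F) ≠ 0) : Nat.card (ZH H) = 2 := by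
  have hne : (1 : SL(2, F)) ≠ -1 := by
    intro h
    have := congrArg (fun z : SL(2, F) => z.1 0 0) h
    simp only [sn00, so00] at this
    apply h2F; linear_combination this
  have : (ZH H : Set H) = {1, ⟨-1, hneg⟩} := by
    ext x
    simp only [SetLike.mem_coe, mem_ZH, Set.mem_insert_iff, Set.mem_singleton_iff]
    constructor
    · rintro ⟨a, b, c⟩
      rcases scalar_pm a b c with h | h
      · left; exact Subtype.ext h
      · right; exact Subtype.ext h
    · rintro (rfl | rfl) <;> simp 
  have h3 : Nat.card (ZH H : Set H) = 2 := by
    rw [Nat.card_coe_set_eq, this, Set.ncard_pair]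
    intro h; exact hne (congrArg Subtype.val h)
  exact h3

lemma conjC_ss {H : Subgroup SL(2, F)} (h2F : (2 : F) ≠ 0) (x : H) (hx : x ∉ ZH H) (ht : str x.1 ^ 2 ≠ 4) [Finite F] :
    Nat.card (conjC x) = 1 ∨ Nat.card (conjC x) = 2 := by
  have hsub : conjC x ⊆ {x, x⁻¹} := by
    rintro y ⟨hy, g, hg⟩
    have htr : str y.1 = str x.1 := by rw [hg]; exact str_conj _ _
    rw [comm_sub, scomm_iff] at hy
    obtain ⟨a1, a2, a3⟩ := hy
    have d1 := sdet x.1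
    have d2 := sdet y.1
    rw [mem_ZH] at hx
    have hα : ∃ α, y.1.1 0 1 = α * x.1.1 0 1 ∧ y.1.1 1 0 = α * x.1.1 1 0 ∧ 
        y.1.1 0 0 - y.1.1 1 1 = α * (x.1.1 0 0 - x.1.1 1 1) := by
      by_cases h1 : x.1.1 0 1 = 0
      · by_cases h2 : x.1.1 1 0 = 0
        · have h0 : x.1.1 0 0 - x.1.1 1 1 ≠ 0 := fun h => hx ⟨h1, h2, sub_eq_zero.1 h⟩
          refine ⟨(y.1.1 0 0 - y.1.1 1 1) / (x.1.1 0 0 - x.1.1 1 1), ?_, ?_, ?_⟩ <;> field_simp <;> grind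
        · refine ⟨y.1.1 1 0 / x.1.1 1 0, ?_, ?_, ?_⟩ <;> field_simp <;> grind
      · refine ⟨y.1.1 0 1 / x.1.1 0 1, ?_, ?_, ?_⟩ <;> field_simp <;> grind
    obtain ⟨α, b1, b2, b3⟩ := hα
    unfold str at ht htr
    have hα2 : (α - 1) * (α + 1) = 0 := by
      have hne : (x.1.1 0 0 + x.1.1 1 1) ^ 2 - 4 ≠ 0 := sub_ne_zero.2 ht
      apply mul_right_cancel₀ hne
      have e1 : (x.1.1 0 0 + x.1.1 1 1) ^ 2 - 4 = (x.1.1 0 0 - x.1.1 1 1) ^ 2 + 4 * (x.1.1 0 1 * x.1.1 1 0) := by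
        linear_combination 4 * d1
      have e2 : (y.1.1 0 0 + y.1.1 1 1) ^ 2 - 4 = (y.1.1 0 0 - y.1.1 1 1) ^ 2 + 4 * (y.1.1 0 1 * y.1.1 1 0) := by
        linear_combination 4 * d2
      rw [b1, b2, b3, htr] at e2
      linear_combination α^2 * e1 - e2
    rcases mul_eq_zero.1 hα2 with h | h
    · left
      have : α = 1 := by linear_combination h
      subst this
      apply Subtype.ext
      apply sext
      · apply mul_left_cancel₀ h2F; linear_combination b3 + htr
      · linear_combination b1
      · linear_combination b2
      · apply mul_left_cancel₀ h2F; linear_combination htr - b3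
    · right
      have : α = -1 := by linear_combination h
      subst this
      apply Subtype.ext
      show y.1 = (x.1)⁻¹
      apply sext <;> simp only [si00, si01, si10, si11]
      · apply mul_left_cancel₀ h2F; linear_combination b3 + htr
      · linear_combination b1
      · linear_combination b2
      · apply mul_left_cancel₀ h2F; linear_combination htr - b3
  have hle := Set.ncard_le_ncard hsub
  have h2 := Set.ncard_insert_le x {x⁻¹}
  rw [Set.ncard_singleton] at h2
  have h3 : 0 < (conjC x).ncard := by
    rw [Set.ncard_pos]
    exact ⟨x, Commute.refl _, 1, by simp⟩
  rw [Nat.card_coe_set_eq]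
  omega

end sl2field

section sl2fieldB
set_option linter.unusedSectionVars false
set_option linter.unnecessarySeqFocus false
set_option maxHeartbeats 1000000
variable {F : Type*} [Field F] [Finite F]

lemma tr_of_pow (p : ℕ) [Fact p.Prime] [CharP F p] {y : SL(2, F)} (h : y ^ p = 1) : str y = 2 := by
  have h1 : (y.1) ^ p = 1 := by
    have := congrArg Subtype.val h
    simpa using this
  have h2 : (y.1 - 1) ^ p = 0 := by
    rw [sub_pow_char_of_commute p (Commute.one_right _), h1]; simp
  have h3 : IsNilpotent (y.1 - 1) := ⟨p, h2⟩
  have h4 := (Matrix.isNilpotent_trace_of_isNilpotent h3).eq_zero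
  simp [Matrix.trace_fin_two] at h4
  unfold str
  linear_combination h4

lemma pow_of_tr (p : ℕ) [Fact p.Prime] [CharP F p] {y : SL(2, F)} (h : str y = 2) : y ^ p = 1 := by
  have hd := sdet y
  unfold str at h
  have h2 : (y.1 - 1) ^ 2 = 0 := by
    rw [pow_two]
    have e : y.1 1 1 = 2 - y.1 0 0 := by linear_combination h
    rw [e] at hd
    ext i j
    fin_cases i <;> fin_cases j <;> simp [Matrix.mul_apply, Fin.sum_univ_two, e]
    · linear_combination -hd
    · ring
    · ring
    · linear_combination -hd
  have h3 : (y.1 - 1) ^ p = 0 := pow_eq_zero_of_le (Fact.out : p.Prime).two_le h2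
  rw [sub_pow_char_of_commute p (Commute.one_right _), one_pow, sub_eq_zero] at h3
  apply Subtype.ext
  simpa using h3


abbrev uu {H : Subgroup SL(2, F)} {μ : F} (hu : e12 μ ∈ H) : H := ⟨e12 μ, hu⟩

lemma uu_notin {H : Subgroup SL(2, F)} {μ : F} (hμ : μ ≠ 0) (hu : e12 μ ∈ H) : uu hu ∉ ZH H := by
  rw [mem_ZH]; rintro ⟨h, _⟩; exact hμ h

lemma comm_uu {H : Subgroup SL(2, F)} {μ : F} (hμ : μ ≠ 0) (hu : e12 μ ∈ H) (y : H) : Commute y (uu hu) ↔ y.1.1 1 0 = 0 ∧ y.1.1 0 0 = y.1.1 1 1 := by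
  rw [comm_sub, scomm_iff]
  simp only [e12_00, e12_01, e12_10, e12_11]
  constructor
  · rintro ⟨h1, h2, h3⟩
    simp [hμ] at h1 h2
    exact ⟨h1, by linear_combination h2⟩
  · rintro ⟨h1, h2⟩
    simp [h1, h2]

lemma p_ne_two (p : ℕ) [Fact p.Prime] [CharP F p] (h2F : (2 : F) ≠ 0) : p ≠ 2 := by
  rintro rfl
  apply h2F
  exact_mod_cast CharP.cast_eq_zero F 2

/-- the central elements of p-power order are trivial -/
lemma ZH_of_order {H : Subgroup SL(2, F)} (h2F : (2 : F) ≠ 0) {y : H} (hy : y ∈ ZH H) (hp : str y.1 = 2) : y = 1 := by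
  obtain ⟨h1, h2, h3⟩ := hy
  rcases scalar_pm h1 h2 h3 with h | h
  · exact Subtype.ext h
  · exfalso
    rw [h] at hp
    unfold str at hp
    simp only [sn00, sn11, so00, so11] at hp
    have : (2 : F) * 2 = 0 := by linear_combination -hp
    simp [h2F] at this

lemma mem_cls_uu (p : ℕ) [Fact p.Prime] [CharP F p] {H : Subgroup SL(2, F)} (hneg : (-1 : SL(2, F)) ∈ H) (h2F : (2 : F) ≠ 0)
    {μ : F} (hμ : μ ≠ 0) (hu : e12 μ ∈ H)
    (x : H) (hx : x ∉ ZH H) : x ∈ clsS (ZH H) (uu hu) ↔ str x.1 ^ 2 = 4 := by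
  have hpp : p.Prime := Fact.out
  constructor
  · rintro ⟨_, g, hg⟩
    rw [comm_uu hμ hu] at hg
    have h1 : str (g * x * g⁻¹ : H).1 = str x.1 := str_conj _ _
    rw [← h1]
    have hd := sdet (g * x * g⁻¹ : H).1
    rw [hg.1, hg.2] at hd
    unfold str
    rw [hg.2]
    linear_combination 4 * hd
  · -- first trace 2
    have main : ∀ x : H, x ∉ ZH H → str x.1 = 2 → x ∈ clsS (ZH H) (uu hu) := by
      intro x hx ht
      have pg : ∀ y : H, str y.1 = 2 → IsPGroup p (Subgroup.zpowers y) := by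
        intro y hy
        have : y ^ p = 1 := Subtype.ext (pow_of_tr p hy)
        rw [IsPGroup]
        rintro ⟨z, hz⟩
        refine ⟨1, ?_⟩
        obtain ⟨k, rfl⟩ := hz
        apply Subtype.ext
        show (y ^ k) ^ (p ^ 1) = 1
        rw [pow_one, ← zpow_natCast, zpow_comm, zpow_natCast, this, _root_.one_zpow]
      obtain ⟨P, hP⟩ := (pg (uu hu) (by unfold str; simp only [e12_00, e12_11]; norm_num)).exists_le_sylow
      obtain ⟨P', hP'⟩ := (pg x ht).exists_le_sylow
      have huP : uu hu ∈ P := hP (Subgroup.mem_zpowers _)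
      have hxP : x ∈ P' := hP' (Subgroup.mem_zpowers _)
      obtain ⟨g, hg⟩ := MulAction.exists_smul_eq H P' P
      refine ⟨hx, g, ?_⟩
      have hgx : g * x * g⁻¹ ∈ P := by
        rw [← hg]
        have : g * x * g⁻¹ ∈ (g • P' : Sylow p H).toSubgroup := by
          exact Subgroup.smul_mem_pointwise_smul x (MulAut.conj g) _ hxP
        exact this
      -- P commutes with u
      have hnt : Nontrivial P := ⟨⟨⟨uu hu, huP⟩, 1, fun h => uu_notin hμ hu (by
        have := congrArg Subtype.val h
        simp only at this
        rw [this]; exact (ZH H).one_mem)⟩⟩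
      have := P.2.center_nontrivial
      obtain ⟨z, hz⟩ := exists_ne (1 : Subgroup.center P)
      have hz1 : (z : P).1 ≠ 1 := by
        intro h; apply hz; apply Subtype.ext; apply Subtype.ext; exact h
      have hzZ : (z : P).1 ∉ ZH H := by
        intro h
        obtain ⟨k, hk⟩ := P.2 (z : P)
        have hk' : ((z : P).1.1) ^ (p ^ k) = 1 := congrArg (fun w : P => w.1.1) hk
        obtain ⟨h1, h2, h3⟩ := h
        rcases scalar_pm h1 h2 h3 with h | h
        · exact hz1 (Subtype.ext h)
        · rw [h, Odd.neg_one_pow ((hpp.odd_of_ne_two (p_ne_two (F := F) p h2F)).pow)] at hk'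
          have := congrArg (fun z : SL(2, F) => z.1 0 0) hk'
          simp only [sn00, so00] at this
          apply h2F; linear_combination -this
      have hzc : ∀ w : P, Commute (w.1) (z : P).1 := by
        intro w
        have := (Subgroup.mem_center_iff.1 z.2) w
        exact congrArg Subtype.val this
      exact ZH_CT _ _ _ hzZ (hzc ⟨_, hgx⟩) (hzc ⟨_, huP⟩).symm
    intro ht
    have : (str x.1 - 2) * (str x.1 + 2) = 0 := by linear_combination ht
    rcases mul_eq_zero.1 this with h | h
    · exact main x hx (by linear_combination h)
    · have h1 : (⟨-1, hneg⟩ * x : H) ∉ ZH H := by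
        have : (⟨-1, hneg⟩ : H) ∈ ZH H := by rw [mem_ZH]; simp
        rwa [Subgroup.mul_mem_cancel_left _ this]
      obtain ⟨_, g, hg⟩ := main _ h1 (by
        unfold str at h ⊢
        simp only [Subgroup.coe_mul, neg_mul, one_mul, sn00, sn11]
        linear_combination -h)
      refine ⟨hx, g, ?_⟩
      rw [comm_sub] at hg ⊢
      have e : (g * (⟨-1, hneg⟩ * x) * g⁻¹ : H).1 = - (g * x * g⁻¹ : H).1 := by simp
      rw [e] at hg
      simpa using hg

lemma other_card (p : ℕ) [Fact p.Prime] [CharP F p] {H : Subgroup SL(2, F)} (hneg : (-1 : SL(2, F)) ∈ H) (h2F : (2 : F) ≠ 0)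
    {μ : F} (hμ : μ ≠ 0) (hu : e12 μ ∈ H)
    (x : H) (hx : x ∉ ZH H) (hxu : x ∉ clsS (ZH H) (uu hu)) :
    ∃ w, 2 ≤ w ∧ Nat.card {y : H | Commute y x} = 2 * w ∧ Nat.Coprime w p := by
  have hpp : p.Prime := Fact.out
  have hcen : Nat.card (Subgroup.centralizer {x}) = Nat.card {y : H | Commute y x} := by
    apply Nat.card_congr
    apply Equiv.subtypeEquivRight
    intro a
    rw [Subgroup.mem_centralizer_singleton_iff]
    rfl
  have hle : ZH H ≤ Subgroup.centralizer {x} := by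
    intro z hz
    rw [Subgroup.mem_centralizer_singleton_iff]
    exact ZH_central z hz x
  have hd := Subgroup.card_dvd_of_le hle
  rw [ZH_card hneg h2F] at hd
  obtain ⟨w, hw⟩ := hd
  refine ⟨w, ?_, by rw [← hcen, hw], ?_⟩
  · have h0 : 0 < Nat.card (Subgroup.centralizer {x}) := Nat.card_pos
    by_contra hlt
    have : w = 1 := by omega
    subst this
    have h3 := Subgroup.eq_of_le_of_card_ge hle (by rw [ZH_card hneg h2F, hw])
    apply hx
    rw [h3, Subgroup.mem_centralizer_singleton_iff]
  · rw [Nat.coprime_comm, Nat.Prime.coprime_iff_not_dvd hpp]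
    intro hdv
    obtain ⟨y, hy⟩ := exists_prime_orderOf_dvd_card' (G := Subgroup.centralizer {x}) p (by rw [hw]; exact dvd_mul_of_dvd_right hdv 2)
    have hyp : y ^ p = 1 := by rw [← hy]; exact pow_orderOf_eq_one y
    have hyp' : (y.1.1) ^ p = 1 := congrArg (fun w : Subgroup.centralizer {x} => w.1.1) hyp
    have ht := tr_of_pow p hyp'
    have hyZ : y.1 ∉ ZH H := by
      intro h
      have := ZH_of_order h2F h ht
      have : y = 1 := Subtype.ext this
      rw [this, orderOf_one] at hy
      exact hpp.one_lt.ne hy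
    obtain ⟨_, g, hg⟩ := (mem_cls_uu p hneg h2F hμ hu y.1 hyZ).2 (by rw [ht]; norm_num)
    apply hxu
    have hyx : Commute y.1 x := by
      have := y.2
      rw [Subgroup.mem_centralizer_singleton_iff] at this
      exact this
    exact ⟨hx, g, ZH_CT _ _ _ (conj_notin ZH_central hyZ g) (comm_conj g hyx.symm) hg⟩

end sl2fieldB

section sl2fieldC
set_option linter.unusedSectionVars false
set_option linter.unnecessarySeqFocus false
set_option maxHeartbeats 1000000
variable {F : Type*} [Field F] [Finite F]

lemma mem_upX {H : Subgroup SL(2, F)} {x : F} : x ∈ upX H ↔ e12 x ∈ H := Iff.rfl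

lemma card_cent_uu {H : Subgroup SL(2, F)} (hneg : (-1 : SL(2, F)) ∈ H) (h2F : (2 : F) ≠ 0)
    {μ : F} (hμ : μ ≠ 0) (hu : e12 μ ∈ H) :
    Nat.card {y : H | Commute y (uu hu)} = 2 * Nat.card (upX H) := by
  have hZc := ZH_card hneg h2F
  suffices hs : Nat.card {y : H | Commute y (uu hu)} = Nat.card (ZH H) * Nat.card (upX H) by
    rw [hs, hZc]
  rw [← Nat.card_prod]
  symm
  refine Nat.card_congr (Equiv.ofBijective 
    (fun w : ZH H × upX H => (⟨w.1.1 * ⟨e12 w.2.1, w.2.2⟩, ?_⟩ : {y : H | Commute y (uu hu)})) ⟨?_, ?_⟩)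
  · obtain ⟨⟨z, h1, h2, h3⟩, x⟩ := w
    show Commute _ _
    rw [comm_uu hμ hu]
    simp only [Subgroup.coe_mul, sm00, sm01, sm10, sm11, e12_00, e12_01, e12_10, e12_11, h1, h2, h3]
    simp
  · rintro ⟨⟨z, h1, h2, h3⟩, ⟨x, hx⟩⟩ ⟨⟨z', h1', h2', h3'⟩, ⟨x', hx'⟩⟩ h
    have h := congrArg (fun w : {y : H | Commute y (uu hu)} => w.1.1) h
    simp only [Subgroup.coe_mul] at h
    have a1 := congrArg (fun z : SL(2, F) => z.1 0 0) h
    have a2 := congrArg (fun z : SL(2, F) => z.1 0 1) h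
    simp only [sm00, sm01, e12_00, e12_01, e12_10, e12_11, h1, h2, h3, h1', h2', h3'] at a1 a2
    have hd := sdet z.1
    have a3 : z.1.1 1 1 = z'.1.1 1 1 := by linear_combination a1
    have hz : z = z' := by
      apply Subtype.ext
      apply sext
      · rw [h3, h3', a3]
      · rw [h1, h1']
      · rw [h2, h2']
      · exact a3
    subst hz
    have hz0 : z.1.1 1 1 ≠ 0 := by
      intro h0; rw [h0, h1] at hd; simp at hd
    have hxx : x = x' := by
      apply mul_left_cancel₀ hz0
      linear_combination a2
    subst hxx
    rfl
  · rintro ⟨y, hy⟩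
    have hy : Commute y (uu hu) := hy
    rw [comm_uu hμ hu] at hy
    have hd := sdet y.1
    rw [hy.1, hy.2] at hd
    have : (y.1.1 1 1 - 1) * (y.1.1 1 1 + 1) = 0 := by linear_combination hd
    rcases mul_eq_zero.1 this with h | h
    · have e : y.1 = e12 (y.1.1 0 1) := by
        apply sext <;> simp only [e12_00, e12_01, e12_10, e12_11, hy.1, hy.2] <;> linear_combination h
      refine ⟨⟨1, ⟨y.1.1 0 1, ?_⟩⟩, ?_⟩
      · rw [mem_upX, ← e]; exact y.2
      · apply Subtype.ext
        apply Subtype.ext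
        simp only [OneMemClass.coe_one, one_mul]
        exact e.symm
    · have e : -y.1 = e12 (-y.1.1 0 1) := by
        apply sext <;> simp only [sn00, sn01, sn10, sn11, e12_00, e12_01, e12_10, e12_11, hy.1, hy.2] <;> 
          first | linear_combination -h | simp
      refine ⟨⟨⟨⟨-1, hneg⟩, by rw [mem_ZH]; simp⟩, ⟨-y.1.1 0 1, ?_⟩⟩, ?_⟩
      · rw [mem_upX, ← e]
        have := H.mul_mem hneg y.2
        simpa using this
      · apply Subtype.ext
        apply Subtype.ext
        simp only [Subgroup.coe_mul]
        rw [← e]; simp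

lemma conjC_uu {H : Subgroup SL(2, F)} (h2F : (2 : F) ≠ 0)
    {μ : F} (hμ : μ ≠ 0) (hu : e12 μ ∈ H) :
    1 ≤ Nat.card (conjC (uu hu)) ∧ Nat.card (conjC (uu hu)) + 1 ≤ Nat.card (upX H) := by
  have hform : ∀ y ∈ conjC (uu hu), y.1 = e12 (y.1.1 0 1) := by
    rintro y ⟨hy, g, hg⟩
    rw [comm_uu hμ hu] at hy
    have ht : str y.1 = str (e12 μ) := by
      rw [hg]; exact str_conj _ _
    unfold str at ht
    simp only [e12_00, e12_11, hy.2] at ht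
    have h1 : y.1.1 1 1 = 1 := by
      apply mul_left_cancel₀ h2F; linear_combination ht
    apply sext <;> simp only [e12_00, e12_01, e12_10, e12_11, hy.1, hy.2, h1]
  have hself : uu hu ∈ conjC (uu hu) := ⟨Commute.refl _, 1, by simp⟩
  constructor
  · rw [Nat.card_coe_set_eq]
    have := (Set.ncard_pos (s := conjC (uu hu))).2 ⟨_, hself⟩
    omega
  · have h0 : (0 : F) ∈ (upX H : Set F) := (upX H).zero_mem
    have h1 := Set.ncard_sdiff_singleton_add_one h0
    have h2 : (conjC (uu hu)).ncard ≤ ((upX H : Set F) \ {0}).ncard := by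
      apply Set.ncard_le_ncard_of_injOn (fun y => y.1.1 0 1)
      · intro y hy
        refine ⟨?_, ?_⟩
        · show _ ∈ upX H
          rw [mem_upX, ← hform y hy]; exact y.2
        · simp only [Set.mem_singleton_iff]
          intro h
          have h3 := hform y hy
          rw [h, e12_zero] at h3
          obtain ⟨_, g, hg⟩ := hy
          have h4 : y = 1 := Subtype.ext h3
          rw [h4] at hg
          have h5 : uu hu = 1 := by
            have : uu hu = g⁻¹ * (g * uu hu * g⁻¹) * g := by group
            rw [this, ← hg]; group
          apply uu_notin hμ hu
          rw [h5]; exact (ZH H).one_mem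
      · intro y hy y' hy' h
        apply Subtype.ext
        rw [hform y hy, hform y' hy']
        simp only at h
        rw [h]
    have h3 : Nat.card (upX H) = (upX H : Set F).ncard := rfl
    rw [Nat.card_coe_set_eq, h3]
    omega

lemma mem_normN_uu {H : Subgroup SL(2, F)} 
    {μ : F} (hμ : μ ≠ 0) (hu : e12 μ ∈ H) (h : H) :
    h ∈ normN ZH_CT ZH_central (uu hu) (uu_notin hμ hu) ↔ h.1.1 1 0 = 0 := by
  show Commute _ _ ↔ _
  rw [comm_uu hμ hu]
  have e1 : (h * uu hu * h⁻¹ : H).1.1 1 0 = - μ * h.1.1 1 0 ^ 2 := by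
    simp only [Subgroup.coe_mul, Subgroup.coe_inv, sm00, sm01, sm10, sm11, si00, si01, si10, si11, e12_00, e12_01, e12_10, e12_11]
    ring
  have e2 : (h * uu hu * h⁻¹ : H).1.1 0 0 - (h * uu hu * h⁻¹ : H).1.1 1 1 = - 2 * μ * h.1.1 0 0 * h.1.1 1 0 := by
    simp only [Subgroup.coe_mul, Subgroup.coe_inv, sm00, sm01, sm10, sm11, si00, si01, si10, si11, e12_00, e12_01, e12_10, e12_11]
    ring
  rw [e1, ← sub_eq_zero (a := (h * uu hu * h⁻¹ : H).1.1 0 0), e2]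
  constructor
  · rintro ⟨h1, _⟩
    simpa [hμ] using h1
  · intro h; simp [h]

lemma torus_card {H : Subgroup SL(2, F)} 
    {μ : F} (hμ : μ ≠ 0) (hu : e12 μ ∈ H) (t : H) (ht : t.1.1 1 0 = 0) (hne : t.1.1 0 0 ≠ t.1.1 1 1) :
    Nat.card (upX H) * Nat.card {y : H | Commute y t} = Nat.card (normN ZH_CT ZH_central (uu hu) (uu_notin hμ hu)) := by
  have hdt := sdet t.1
  rw [ht] at hdt
  have hne' : t.1.1 0 0 - t.1.1 1 1 ≠ 0 := sub_ne_zero.2 hne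
  have hcomm : ∀ y : H, Commute y t ↔ y.1.1 1 0 = 0 ∧ y.1.1 0 1 * (t.1.1 0 0 - t.1.1 1 1) = t.1.1 0 1 * (y.1.1 0 0 - y.1.1 1 1) := by
    intro y
    rw [comm_sub, scomm_iff, ht]
    constructor
    · rintro ⟨h1, h2, h3⟩
      have : y.1.1 1 0 = 0 := by simpa [hne'] using h3
      exact ⟨this, h2⟩
    · rintro ⟨h1, h2⟩
      simp [h1, h2]
  -- division by a^2 - 1 in upX
  have hdiv : ∀ z ∈ upX H, ∃ x ∈ upX H, (t.1.1 0 0 ^ 2 - 1) * x = z := by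
    have hmul : ∀ x ∈ upX H, (t.1.1 0 0 ^ 2 - 1) * x ∈ upX H := by
      intro x hx
      have e : e12 ((t.1.1 0 0 ^ 2 - 1) * x) = t.1 * e12 x * t.1⁻¹ * (e12 x)⁻¹ := by
        apply sext <;> simp only [sm00, sm01, sm10, sm11, si00, si01, si10, si11, e12_00, e12_01, e12_10, e12_11, ht]
        · linear_combination -hdt
        · linear_combination x * hdt
        · ring
        · linear_combination -hdt
      rw [mem_upX, e]
      exact H.mul_mem (H.mul_mem (H.mul_mem t.2 hx) (H.inv_mem t.2)) (H.inv_mem hx)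
    have hinj : Function.Injective (fun x : upX H => (⟨(t.1.1 0 0 ^ 2 - 1) * x.1, hmul x.1 x.2⟩ : upX H)) := by
      intro x y h
      have h := congrArg Subtype.val h
      simp only at h
      apply Subtype.ext
      refine mul_left_cancel₀ ?_ h
      intro h0
      apply hne'
      have : t.1.1 0 0 ≠ 0 := by
        intro h; rw [h] at hdt; simp at hdt
      apply mul_left_cancel₀ this
      linear_combination h0 - hdt
    intro z hz
    obtain ⟨x, hx⟩ := Finite.surjective_of_injective hinj ⟨z, hz⟩
    exact ⟨x.1, x.2, congrArg Subtype.val hx⟩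
  rw [← Nat.card_prod]
  refine Nat.card_congr (Equiv.ofBijective 
    (fun w : upX H × {y : H | Commute y t} => 
      (⟨⟨e12 w.1.1, w.1.2⟩ * w.2.1, ?_⟩ : normN ZH_CT ZH_central (uu hu) (uu_notin hμ hu))) ⟨?_, ?_⟩)
  · rw [mem_normN_uu hμ hu]
    have := ((hcomm _).1 w.2.2).1
    simp only [Subgroup.coe_mul, sm10, e12_10, e12_11, this]
    simp
  · rintro ⟨⟨x, hx⟩, ⟨y, hy⟩⟩ ⟨⟨x', hx'⟩, ⟨y', hy'⟩⟩ h
    have h := congrArg (fun w : normN ZH_CT ZH_central (uu hu) (uu_notin hμ hu) => w.1) h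
    simp only at h
    have hy := (show Commute y t from hy)
    have hy' := (show Commute y' t from hy')
    have h3 : (⟨e12 (-x' + x), by rw [e12_add, e12_neg]; exact H.mul_mem (H.inv_mem hx') hx⟩ : H) = y' * y⁻¹ := by
      have : (⟨e12 (-x' + x), by rw [e12_add, e12_neg]; exact H.mul_mem (H.inv_mem hx') hx⟩ : H) = (⟨e12 x', hx'⟩ : H)⁻¹ * ⟨e12 x, hx⟩ := by
        apply Subtype.ext
        simp [e12_add, e12_neg]
      rw [this]
      calc _ = (⟨e12 x', hx'⟩ : H)⁻¹ * (⟨e12 x, hx⟩ * y) * y⁻¹ := by group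
        _ = _ := by rw [h]; group
    have h4 : Commute (y' * y⁻¹) t := hy'.mul_left hy.inv_left
    rw [← h3, hcomm] at h4
    have h5 := h4.2
    simp only [e12_00, e12_01, e12_11] at h5
    have h6 : -x' + x = 0 := by simpa [hne'] using h5
    have hxx : x = x' := by linear_combination h6
    subst hxx
    have : y = y' := mul_left_cancel h
    subst this
    rfl
  · rintro ⟨n, hn⟩
    have hn' := (mem_normN_uu hμ hu n).1 hn
    have hdn := sdet n.1
    rw [hn'] at hdn
    have ez : n.1 * t.1 * n.1⁻¹ * t.1⁻¹ = e12 ((n.1 * t.1 * n.1⁻¹ * t.1⁻¹).1 0 1) := by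
      apply sext <;> simp only [sm00, sm01, sm10, sm11, si00, si01, si10, si11, e12_00, e12_01, e12_10, e12_11, ht, hn']
      · linear_combination hdn + n.1.1 0 0 * n.1.1 1 1 * hdt
      · ring
      · linear_combination hdn + n.1.1 0 0 * n.1.1 1 1 * hdt
    have hzX : (n.1 * t.1 * n.1⁻¹ * t.1⁻¹).1 0 1 ∈ upX H := by
      rw [mem_upX, ← ez]
      exact H.mul_mem (H.mul_mem (H.mul_mem n.2 t.2) (H.inv_mem n.2)) (H.inv_mem t.2)
    obtain ⟨x, hx, hxz⟩ := hdiv _ ((upX H).neg_mem hzX)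
    refine ⟨⟨⟨x, hx⟩, ⟨(⟨e12 x, hx⟩ : H)⁻¹ * n, ?_⟩⟩, ?_⟩
    · show Commute _ _
      rw [hcomm]
      simp only [Subgroup.coe_mul, Subgroup.coe_inv, sm00, sm01, sm10, sm11, si00, si01, si10, si11, e12_00, e12_01, e12_10, e12_11, hn'] at hxz ⊢
      rw [ht] at hxz
      refine ⟨by ring, ?_⟩
      grind
    · apply Subtype.ext
      simp only
      group

end sl2fieldC

section sl2fieldD
set_option linter.unusedSectionVars false
set_option linter.unusedSimpArgs false
set_option linter.unnecessarySeqFocus false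
set_option maxHeartbeats 1000000
variable {F : Type*} [Field F] [Finite F]

lemma upX_card_pow (p : ℕ) [Fact p.Prime] [CharP F p] {H : Subgroup SL(2, F)}
    {μ : F} (hμ : μ ≠ 0) (hu : e12 μ ∈ H) :
    ∃ k, 1 ≤ k ∧ Nat.card (upX H) = p ^ k := by
  have h1 : Nat.card (upX H) ∣ Nat.card F := AddSubgroup.card_addSubgroup_dvd_card _
  have := Fintype.ofFinite F
  obtain ⟨n, hp, hn⟩ := FiniteField.card F p
  rw [Nat.card_eq_fintype_card (α := F), hn] at h1
  obtain ⟨k, hk, hk2⟩ := (Nat.dvd_prime_pow hp).1 h1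
  refine ⟨k, ?_, hk2⟩
  by_contra hk0
  have : k = 0 := by omega
  subst this
  rw [pow_zero, Nat.card_eq_one_iff_unique] at hk2
  have := hk2.1.elim (⟨μ, hu⟩ : upX H) ⟨0, (upX H).zero_mem⟩
  exact hμ (congrArg Subtype.val this)

lemma field_dich (p : ℕ) [Fact p.Prime] [CharP F p] {H : Subgroup SL(2, F)}
    (hneg : (-1 : SL(2, F)) ∈ H) (h2F : (2 : F) ≠ 0)
    {μ : F} (hμ : μ ≠ 0) (hu : e12 μ ∈ H) (h21 : e21 (1 : F) ∈ H) :
    (normN ZH_CT ZH_central (uu hu) (uu_notin hμ hu)).index = Nat.card (upX H) + 1 ∨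
    (Nat.card (upX H) = 3 ∧ ∀ x : H, x ∉ ZH H → str x.1 ^ 2 ≠ 4 → x ^ 4 = 1 ∨ x ^ 10 = 1) := by
  obtain ⟨k, hk, hq⟩ := upX_card_pow p hμ hu
  have hpp : p.Prime := Fact.out
  have hp2 : p ≠ 2 := p_ne_two (F := F) p h2F
  have hpodd : Odd p := hpp.odd_of_ne_two hp2
  have hp3 : 3 ≤ p := by have := hpp.two_le; omega
  have hcu := card_cent_uu hneg h2F hμ hu
  obtain ⟨hc1, hc2⟩ := conjC_uu h2F hμ hu
  have hcn := card_normN ZH_CT ZH_central (uu hu) (uu_notin hμ hu)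
  have hidx := (normN ZH_CT ZH_central (uu hu) (uu_notin hμ hu)).card_mul_index
  have := dickson_count ZH_CT ZH_central (ZH_card hneg h2F) (uu hu) (uu_notin hμ hu)
    (Nat.card (upX H)) (Nat.card (conjC (uu hu))) (normN ZH_CT ZH_central (uu hu) (uu_notin hμ hu)).index
    (by rw [hq]; exact hp3.trans (Nat.le_self_pow (by omega) p))
    (by rw [hq]; exact hpodd.pow) hcu rfl hc1 hc2
    (by rw [← hidx, hcn, hcu]; ring)
    (by
      have h0 : (normN ZH_CT ZH_central (uu hu) (uu_notin hμ hu)).index ≠ 0 := Subgroup.index_ne_zero_of_finite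
      have h1 : (normN ZH_CT ZH_central (uu hu) (uu_notin hμ hu)).index ≠ 1 := by
        rw [Ne, Subgroup.index_eq_one]
        intro h
        have : (⟨e21 1, h21⟩ : H) ∈ normN ZH_CT ZH_central (uu hu) (uu_notin hμ hu) := by
          rw [h]; trivial
        rw [mem_normN_uu hμ hu] at this
        simp [e21_10] at this
      omega)
    (by
      intro hc
      have : 1 < Nat.card (conjC (uu hu)) := hc
      rw [Finite.one_lt_card_iff_nontrivial] at this
      obtain ⟨⟨y, hyc, h, hy⟩, hne⟩ := exists_ne (⟨uu hu, Commute.refl _, 1, by simp⟩ : conjC (uu hu))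
      have hmem : h ∈ normN ZH_CT ZH_central (uu hu) (uu_notin hμ hu) := by
        show Commute _ _
        rw [← hy]; exact hyc
      have h10 := (mem_normN_uu hμ hu h).1 hmem
      have hne2 : h.1.1 0 0 ≠ h.1.1 1 1 := by
        intro h00
        apply hne
        apply Subtype.ext
        have : Commute h (uu hu) := (comm_uu hμ hu h).2 ⟨h10, h00⟩
        show y = uu hu
        rw [hy, this.eq, mul_inv_cancel_right]
      have hZ : h ∉ ZH H := by
        rw [mem_ZH]; rintro ⟨_, _, h3⟩; exact hne2 h3
      refine ⟨h, hZ, ?_, ?_⟩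
      · rw [mem_cls_uu p hneg h2F hμ hu h hZ]
        intro ht
        have hd := sdet h.1
        rw [h10] at hd
        unfold str at ht
        apply hne2
        have : (h.1.1 0 0 - h.1.1 1 1) ^ 2 = 0 := by linear_combination ht - 4 * hd
        exact sub_eq_zero.1 (pow_eq_zero_iff (two_ne_zero) |>.1 this)
      · have ht := torus_card hμ hu h h10 hne2
        rw [hcn, hcu] at ht
        have hpos : 0 < Nat.card (upX H) := Nat.card_pos
        apply Nat.eq_of_mul_eq_mul_left hpos
        rw [ht]; ring)
    (by
      intro x hx hxu
      refine ⟨conjC_ss h2F x hx ?_, ?_⟩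
      · intro h; exact hxu ((mem_cls_uu p hneg h2F hμ hu x hx).2 h)
      · obtain ⟨w, h1, h2, h3⟩ := other_card p hneg h2F hμ hu x hx hxu
        exact ⟨w, h1, h2, by rw [hq]; exact h3.pow_right k⟩)
  rcases this with h | ⟨h, h'⟩
  · exact Or.inl h
  · refine Or.inr ⟨h, fun x hx ht => h' x hx ?_⟩
    rw [mem_cls_uu p hneg h2F hμ hu x hx]; exact ht

lemma big_cell (p : ℕ) [Fact p.Prime] [CharP F p] {H : Subgroup SL(2, F)}
    (hneg : (-1 : SL(2, F)) ∈ H) (h2F : (2 : F) ≠ 0)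
    {μ : F} (hμ : μ ≠ 0) (hu : e12 μ ∈ H) (h21 : e21 (1 : F) ∈ H)
    (hM : (normN ZH_CT ZH_central (uu hu) (uu_notin hμ hu)).index = Nat.card (upX H) + 1)
    (h : SL(2, F)) (hh : h ∈ H) (h10 : h.1 1 0 ≠ 0) :
    ∃ x, e12 x ∈ H ∧ h.1 0 0 = x * h.1 1 0 := by
  have hv : (⟨e21 1, h21⟩ : H) ∉ ZH H := by
    rw [mem_ZH]; simp [e21_10]
  have hv2 := (mem_cls_uu p hneg h2F hμ hu _ hv).2 (by unfold str; rw [e21_00, e21_11]; norm_num)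
  obtain ⟨_, g, hg⟩ := hv2
  rw [comm_uu hμ hu] at hg
  have hg1 := hg.1
  simp only [Subgroup.coe_mul, Subgroup.coe_inv, sm00, sm01, sm10, sm11, si00, si01, si10, si11,
    e21_00, e21_01, e21_10, e21_11] at hg1
  have hg11 : g.1.1 1 1 = 0 := by
    have : g.1.1 1 1 ^ 2 = 0 := by linear_combination hg1
    exact pow_eq_zero_iff (two_ne_zero) |>.1 this
  have hdg := sdet g.1
  rw [hg11] at hdg
  have hg10 : g.1.1 1 0 ≠ 0 := by intro h; rw [h] at hdg; simp at hdg
  set N := normN ZH_CT ZH_central (uu hu) (uu_notin hμ hu) with hN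
  have memN : ∀ n : H, n ∈ N ↔ n.1.1 1 0 = 0 := fun n => mem_normN_uu hμ hu n
  let f : upX H × N → {y : H // y ∉ N} := fun w => ⟨⟨e12 w.1.1, w.1.2⟩ * g⁻¹ * w.2.1, by
    have := (memN _).1 w.2.2
    have hd := sdet w.2.1.1
    rw [memN]
    rw [this] at hd
    simp only [Subgroup.coe_mul, Subgroup.coe_inv, sm00, sm01, sm10, sm11, si00, si01, si10, si11, this,
      e12_00, e12_01, e12_10, e12_11, hg11]
    intro h0
    have h3 : g.1.1 1 0 * w.2.1.1.1 0 0 = 0 := by linear_combination -h0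
    rcases mul_eq_zero.1 h3 with h4 | h4
    · exact hg10 h4
    · rw [h4] at hd; simp at hd⟩
  have hf : Function.Injective f := by
    rintro ⟨⟨x, hx⟩, ⟨n, hn⟩⟩ ⟨⟨x', hx'⟩, ⟨n', hn'⟩⟩ hxy
    have h1 := congrArg (fun z : {y : H // y ∉ N} => z.1.1) hxy
    have h2 := (memN _).1 hn
    have h2' := (memN _).1 hn'
    have hd := sdet n.1
    rw [h2] at hd
    have a1 := congrArg (fun z : SL(2, F) => z.1 0 0) h1
    have a2 := congrArg (fun z : SL(2, F) => z.1 1 0) h1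
    simp only [f, Subgroup.coe_mul, Subgroup.coe_inv, sm00, sm01, sm10, sm11, si00, si01, si10, si11, 
      e12_00, e12_01, e12_10, e12_11, hg11, h2, h2'] at a1 a2
    have hn0 : n.1.1 0 0 ≠ 0 := by intro h; rw [h] at hd; simp at hd
    have hxx : x = x' := by
      apply mul_left_cancel₀ (mul_ne_zero hg10 hn0)
      linear_combination - a1 + x' * a2
    subst hxx
    have := congrArg Subtype.val hxy
    simp only [f] at this
    have := mul_left_cancel this
    subst this
    rfl
  have hcard : Nat.card (upX H × N) = Nat.card {y : H // y ∉ N} := by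
    have h1 := N.card_mul_index
    rw [hM] at h1
    have := Fintype.ofFinite H
    classical
    have h2 : Nat.card {y : H // y ∉ N} = Nat.card H - Nat.card N := by
      rw [Nat.card_eq_fintype_card, Nat.card_eq_fintype_card, Nat.card_eq_fintype_card, Fintype.card_subtype_compl]
    rw [h2, Nat.card_prod, ← h1, mul_comm]
    rw [Nat.mul_add, mul_one, Nat.add_sub_cancel]
  have hsurj : Function.Surjective f := by
    exact ((Nat.bijective_iff_injective_and_card f).2 ⟨hf, hcard⟩).2
  obtain ⟨⟨⟨x, hx⟩, ⟨n, hn⟩⟩, hw⟩ := hsurj ⟨⟨h, hh⟩, by rw [memN]; exact h10⟩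
  have h1 := congrArg (fun z : {y : H // y ∉ N} => z.1.1) hw
  have h2 := (memN _).1 hn
  have a1 := congrArg (fun z : SL(2, F) => z.1 0 0) h1
  have a2 := congrArg (fun z : SL(2, F) => z.1 1 0) h1
  simp only [f, Subgroup.coe_mul, Subgroup.coe_inv, sm00, sm01, sm10, sm11, si00, si01, si10, si11, 
      e12_00, e12_01, e12_10, e12_11, hg11, h2] at a1 a2
  exact ⟨x, hx, by linear_combination -a1 + x * a2⟩

lemma full_case (p : ℕ) [Fact p.Prime] [CharP F p] {H : Subgroup SL(2, F)}
    (hneg : (-1 : SL(2, F)) ∈ H) (h2F : (2 : F) ≠ 0)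
    {μ : F} (hμ : μ ≠ 0) (hu : e12 μ ∈ H) (h21 : e21 (1 : F) ∈ H)
    (hgen : Subring.closure {μ} = ⊤)
    (hM : (normN ZH_CT ZH_central (uu hu) (uu_notin hμ hu)).index = Nat.card (upX H) + 1) :
    H = ⊤ := by
  have hbc := big_cell p hneg h2F hμ hu h21 hM
  have h1X : e12 (1 : F) ∈ H := by
    obtain ⟨x, hx, h⟩ := hbc _ h21 (by rw [e21_10]; exact one_ne_zero)
    rw [e21_00, e21_10, mul_one] at h
    rw [h]; exact hx
  have hw : e12 (-1 : F) * e21 1 * e12 (-1) ∈ H := by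
    have := (upX H).neg_mem (show (1 : F) ∈ upX H from h1X)
    exact H.mul_mem (H.mul_mem this h21) this
  have hXY : ∀ x : F, e12 x ∈ H → e21 x ∈ H := by
    intro x hx
    have h1 : e12 (-x) ∈ H := (upX H).neg_mem hx
    have : e21 x = (e12 (-1 : F) * e21 1 * e12 (-1)) * e12 (-x) * (e12 (-1 : F) * e21 1 * e12 (-1))⁻¹ := by
      apply sext <;> simp only [sm00, sm01, sm10, sm11, si00, si01, si10, si11, e12_00, e12_01, e12_10, e12_11,
        e21_00, e21_01, e21_10, e21_11] <;> ring
    rw [this]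
    exact H.mul_mem (H.mul_mem hw h1) (H.inv_mem hw)
  have hinv : ∀ x : F, x ∈ upX H → x⁻¹ ∈ upX H := by
    intro x hx
    by_cases hx0 : x = 0
    · subst hx0; simpa using hx
    obtain ⟨y, hy, h⟩ := hbc _ (hXY x hx) (by rw [e21_10]; exact hx0)
    rw [e21_00, e21_10] at h
    have : x⁻¹ = y := by field_simp; linear_combination h
    rw [this]; exact hy
  have hsq : ∀ a : F, a ∈ upX H → a ^ 2 ∈ upX H := by
    intro a ha
    by_cases h0 : a = 0
    · subst h0; simpa using ha
    by_cases h1 : a = 1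
    · subst h1; simpa using ha
    have h1' : 1 - a ≠ 0 := fun h => h1 (sub_eq_zero.1 h).symm
    have : a ^ 2 = a - (a⁻¹ + (1 - a)⁻¹)⁻¹ := by
      have : a⁻¹ + (1 - a)⁻¹ = (a * (1 - a))⁻¹ := by field_simp; ring
      rw [this, inv_inv]; ring
    rw [this]
    exact (upX H).sub_mem ha (hinv _ ((upX H).add_mem (hinv _ ha) (hinv _ ((upX H).sub_mem h1X ha))))
  have hpodd : Odd p := (Fact.out : p.Prime).odd_of_ne_two (p_ne_two (F := F) p h2F)
  obtain ⟨m, hm⟩ := hpodd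
  have hmul : ∀ a b : F, a ∈ upX H → b ∈ upX H → a * b ∈ upX H := by
    intro a b ha hb
    have h1 : 2 * (a * b) ∈ upX H := by
      have : 2 * (a * b) = (a + b) ^ 2 - a ^ 2 - b ^ 2 := by ring
      rw [this]
      exact (upX H).sub_mem ((upX H).sub_mem (hsq _ ((upX H).add_mem ha hb)) (hsq _ ha)) (hsq _ hb)
    have h2 : a * b = (m + 1) • (2 * (a * b)) := by
      have hp0 : (p : F) = 0 := CharP.cast_eq_zero F p
      rw [hm] at hp0
      push_cast at hp0
      rw [nsmul_eq_mul]
      push_cast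
      linear_combination -(a * b) * hp0
    rw [h2]
    exact (upX H).nsmul_mem h1 _
  have hall : ∀ x : F, e12 x ∈ H := by
    intro x
    have hx : x ∈ Subring.closure {μ} := by rw [hgen]; trivial
    induction hx using Subring.closure_induction with
    | mem x hx => rw [Set.mem_singleton_iff.1 hx]; exact hu
    | zero => exact (upX H).zero_mem
    | one => exact h1X
    | add x y _ _ hx hy => exact (upX H).add_mem hx hy
    | neg x _ hx => exact (upX H).neg_mem hx
    | mul x y _ _ hx hy => exact hmul _ _ hx hy
  exact sl2_gen H hall (fun x => hXY x (hall x))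

end sl2fieldD

section sl2fieldE
set_option linter.unusedSectionVars false
set_option linter.unusedSimpArgs false
set_option linter.unnecessarySeqFocus false
set_option maxHeartbeats 1000000
variable {F : Type*} [Field F]

lemma invol_10 (h2F : (2 : F) ≠ 0) (y : SL(2, F)) (hy : y * y = 1) : y.1 1 0 = 0 := by
  have a1 := congrArg (fun z : SL(2, F) => z.1 0 0) hy
  have a2 := congrArg (fun z : SL(2, F) => z.1 1 0) hy
  simp only [sm00, sm10, so00, so10] at a1 a2
  have hd := sdet y
  have h1 : y.1 1 0 * (y.1 0 0 + y.1 1 1) = 0 := by linear_combination a2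
  rcases mul_eq_zero.1 h1 with h | h
  · exact h
  · exfalso; apply h2F; linear_combination -a1 - hd + y.1 0 0 * h

lemma pow_trace (h2F : (2 : F) ≠ 0) (x : SL(2, F)) (h10 : x.1 1 0 ≠ 0) (hx : x ^ 4 = 1 ∨ x ^ 10 = 1) :
    str x = 0 ∨ str x ^ 4 - 3 * str x ^ 2 + 1 = 0 := by
  have hd := sdet x
  unfold str
  rcases hx with hx | hx
  · left
    have h := invol_10 h2F (x * x) (by rw [← hx]; simp only [pow_succ, pow_zero, one_mul, mul_assoc])
    simp only [sm10] at h
    apply mul_left_cancel₀ h10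
    linear_combination h
  · right
    have h := invol_10 h2F (x * x * (x * x) * x) (by rw [← hx]; simp only [pow_succ, pow_zero, one_mul, mul_assoc])
    simp only [sm00, sm01, sm10, sm11] at h
    apply mul_left_cancel₀ h10
    linear_combination h - x.1 1 0 * (-3 * (x.1 0 0 + x.1 1 1) ^ 2 + (x.1 0 0 * x.1 1 1 - x.1 0 1 * x.1 1 0) + 1) * hd

lemma exc_case [Finite F] (p : ℕ) [Fact p.Prime] [CharP F p] {H : Subgroup SL(2, F)}
    (h2F : (2 : F) ≠ 0)
    {μ : F} (hμ : μ ≠ 0) (hu : e12 μ ∈ H) (h21 : e21 (1 : F) ∈ H)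
    (hgen : Subring.closure {μ} = ⊤) (hex : ¬ (p = 3 ∧ μ ^ 2 = -1))
    (hq : Nat.card (upX H) = 3)
    (hall : ∀ x : H, x ∉ ZH H → str x.1 ^ 2 ≠ 4 → x ^ 4 = 1 ∨ x ^ 10 = 1) : H = ⊤ := by
  obtain ⟨k, hk, hq2⟩ := upX_card_pow p hμ hu
  have hp3 : p = 3 := by
    have h1 : p ∣ 3 := by rw [← hq, hq2]; exact dvd_pow_self p (by omega)
    exact (Nat.prime_dvd_prime_iff_eq Fact.out Nat.prime_three).1 h1
  have h3 : (3 : F) = 0 := by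
    have := CharP.cast_eq_zero F p
    rw [hp3] at this; exact_mod_cast this
  have key : ∀ ν : F, ν ≠ 0 → e12 ν ∈ H → ν = 1 ∨ ν = -1 ∨ ν ^ 2 = -1 ∨ ν ^ 2 - ν - 1 = 0 := by
    intro ν hν hνH
    have hst : str (e21 1 * e12 ν) = 2 + ν := by
      unfold str
      simp only [sm00, sm01, sm10, sm11, e12_00, e12_01, e12_10, e12_11, e21_00, e21_01, e21_10, e21_11]
      ring
    have h10 : (e21 1 * e12 ν).1 1 0 = 1 := by
      simp only [sm00, sm01, sm10, sm11, e12_00, e12_01, e12_10, e12_11, e21_00, e21_01, e21_10, e21_11]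
      ring
    have hx := hall ⟨e21 1 * e12 ν, H.mul_mem h21 hνH⟩
      (by rw [mem_ZH]; rintro ⟨_, h, _⟩; rw [h10] at h; exact one_ne_zero h)
    simp only [hst] at hx
    by_cases h4 : (2 + ν) ^ 2 = 4
    · right; left
      apply mul_left_cancel₀ hν
      linear_combination h4 - ν * h3
    have hx := hx h4
    have hx : (e21 1 * e12 ν) ^ 4 = 1 ∨ (e21 1 * e12 ν) ^ 10 = 1 := by
      rcases hx with hx | hx
      · left; exact congrArg Subtype.val hx
      · right; exact congrArg Subtype.val hx
    rcases pow_trace h2F _ (by rw [h10]; exact one_ne_zero) hx with h | h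
    · rw [hst] at h
      left; linear_combination h - h3
    · rw [hst] at h
      right; right
      have : (ν ^ 2 - ν - 1) * (ν ^ 2 + 1) = 0 := by
        linear_combination h - (3 * ν ^ 3 + 7 * ν ^ 2 + 7 * ν + 2) * h3
      rcases mul_eq_zero.1 this with h | h
      · right; exact h
      · left; linear_combination h
  have hpm : μ = 1 ∨ μ = -1 := by
    have hn : e12 (-μ) ∈ H := (upX H).neg_mem hu
    have k1 := key μ hμ hu
    have k2 := key (-μ) (neg_ne_zero.2 hμ) hn
    have h4 : μ ^ 2 ≠ -1 := fun h => hex ⟨hp3, h⟩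
    rcases k1 with h | h | h | h
    · left; exact h
    · right; exact h
    · exact absurd h h4
    · rcases k2 with h' | h' | h' | h'
      · right; linear_combination -h'
      · left; linear_combination -h'
      · exact absurd (by linear_combination h') h4
      · exfalso; apply mul_ne_zero h2F hμ; linear_combination h' - h
  have h1 : e12 (1 : F) ∈ H := by
    rcases hpm with h | h
    · rw [← h]; exact hu
    · have : (1 : F) = -μ := by rw [h]; ring
      rw [this]; exact (upX H).neg_mem hu
  have hZcast : ∀ x : F, ∃ m : ℤ, x = m := by
    intro x
    have hx : x ∈ Subring.closure {μ} := by rw [hgen]; trivial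
    have hle : Subring.closure {μ} ≤ (Int.castRingHom F).range := by
      rw [Subring.closure_le, Set.singleton_subset_iff]
      rcases hpm with h | h
      · rw [h]; exact Subring.one_mem _
      · rw [h]; exact Subring.neg_mem _ (Subring.one_mem _)
    obtain ⟨m, hm⟩ := hle hx
    exact ⟨m, hm.symm⟩
  apply sl2_gen
  · intro x
    obtain ⟨m, rfl⟩ := hZcast x
    have := (upX H).zsmul_mem h1 m
    rw [zsmul_one] at this
    exact this
  · intro x
    obtain ⟨m, rfl⟩ := hZcast x
    have := (loY H).zsmul_mem h21 m
    rw [zsmul_one] at this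
    exact this

theorem field_full [Finite F] (p : ℕ) [Fact p.Prime] [CharP F p] {H : Subgroup SL(2, F)}
    (hneg : (-1 : SL(2, F)) ∈ H) (h2F : (2 : F) ≠ 0)
    {μ : F} (hμ : μ ≠ 0) (hu : e12 μ ∈ H) (h21 : e21 (1 : F) ∈ H)
    (hgen : Subring.closure {μ} = ⊤) (hex : ¬ (p = 3 ∧ μ ^ 2 = -1)) : H = ⊤ := by
  rcases field_dich p hneg h2F hμ hu h21 with h | ⟨h1, h2⟩
  · exact full_case p hneg h2F hμ hu h21 hgen h
  · exact exc_case p h2F hμ hu h21 hgen hex h1 h2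

end sl2fieldE

section lifting
set_option linter.unusedSimpArgs false
variable {A : Type*} [CommRing A]

def mk2 (a b c d : A) (h : a * d - b * c = 1) : SL(2, A) :=
  ⟨!![a, b; c, d], by rw [Matrix.det_fin_two_of]; exact h⟩
lemma mk2_00 (a b c d : A) (h : a * d - b * c = 1) : (mk2 a b c d h).1 0 0 = a := rfl
lemma mk2_01 (a b c d : A) (h : a * d - b * c = 1) : (mk2 a b c d h).1 0 1 = b := rfl
lemma mk2_10 (a b c d : A) (h : a * d - b * c = 1) : (mk2 a b c d h).1 1 0 = c := rfl
lemma mk2_11 (a b c d : A) (h : a * d - b * c = 1) : (mk2 a b c d h).1 1 1 = d := rfl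

lemma lift_full [IsLocalRing A] (H : Subgroup SL(2, A)) (ε μ : A) (he2 : ε * ε = 0)
    (hem : ∀ m : A, ¬ IsUnit m → ε * m = 0) (hμ : IsUnit μ) (h2 : IsUnit (2 : A))
    (hcong : ∀ g : SL(2, A), ∃ h ∈ H, ∃ a b c d : A, h.1 0 0 = g.1 0 0 + ε * a ∧ h.1 0 1 = g.1 0 1 + ε * b ∧
      h.1 1 0 = g.1 1 0 + ε * c ∧ h.1 1 1 = g.1 1 1 + ε * d)
    (hu : e12 (ε * μ) ∈ H) : H = ⊤ := by
  -- conjugation only depends on the residue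
  have conj : ∀ (g : SL(2, A)) (x : A), e12 (ε * x) ∈ H → g * e12 (ε * x) * g⁻¹ ∈ H := by
    intro g x hx
    obtain ⟨h, hh, a, b, c, d, h00, h01, h10, h11⟩ := hcong g
    have : g * e12 (ε * x) * g⁻¹ = h * e12 (ε * x) * h⁻¹ := by
      have hdg := sdet g
      have hdh := sdet h
      apply sext <;> simp only [sm00, sm01, sm10, sm11, si00, si01, si10, si11, e12_00, e12_01, e12_10, e12_11] <;>
        grind
    rw [this]
    exact H.mul_mem (H.mul_mem hh hx) (H.inv_mem hh)
  have hsq : ∀ a : A, e12 (ε * (μ * a ^ 2)) ∈ H := by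
    intro a
    by_cases ha : IsUnit a
    · obtain ⟨v, rfl⟩ := ha
      have h1 := conj (mk2 (v : A) 0 0 ↑v⁻¹ (by simp)) μ hu
      convert h1 using 1
      have hv : (v : A) * ↑v⁻¹ = 1 := by simp
      apply sext <;> simp only [sm00, sm01, sm10, sm11, si00, si01, si10, si11, e12_00, e12_01, e12_10, e12_11,
        mk2_00, mk2_01, mk2_10, mk2_11]
      · linear_combination -hv
      · ring
      · ring
      · linear_combination -hv
    · have : ε * (μ * a ^ 2) = 0 := by linear_combination μ * a * hem a ha
      rw [this, e12_zero]; exact H.one_mem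
  have hup : ∀ x : A, e12 (ε * x) ∈ H := by
    intro x
    obtain ⟨m, hm⟩ := hμ.exists_right_inv
    obtain ⟨t, ht⟩ := h2.exists_right_inv
    have h1 := (upX H).sub_mem (hsq (m * x * t * t + 1)) (hsq (m * x * t * t - 1))
    have : ε * (μ * (m * x * t * t + 1) ^ 2) - ε * (μ * (m * x * t * t - 1) ^ 2) = ε * x := by
      linear_combination ε * x * (4 * t * t * hm  + (2 * t + 1) * ht)
    rw [this] at h1
    exact h1
  have hlo : ∀ x : A, e21 (ε * x) ∈ H := by
    intro x
    have h1 := conj (mk2 0 (-1) 1 0 (by simp)) (-x) (hup _)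
    convert h1 using 1
    apply sext <;> simp only [sm00, sm01, sm10, sm11, si00, si01, si10, si11, e12_00, e12_01, e12_10, e12_11,
      e21_00, e21_01, e21_10, e21_11, mk2_00, mk2_01, mk2_10, mk2_11] <;> ring
  have hker : ∀ k : SL(2, A), ∀ a b c d : A, k.1 0 0 = 1 + ε * a → k.1 0 1 = ε * b → k.1 1 0 = ε * c →
      k.1 1 1 = 1 + ε * d → k ∈ H := by
    intro k a b c d h00 h01 h10 h11
    have hd := sdet k
    rw [h00, h01, h10, h11] at hd
    have h1 := conj (e21 1) (-a) (hup _)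
    have : k = (e21 1 * e12 (ε * (-a)) * (e21 1)⁻¹) * e12 (ε * (b + a)) * e21 (ε * (c - a)) := by
      apply sext <;> simp only [sm00, sm01, sm10, sm11, si00, si01, si10, si11, e12_00, e12_01, e12_10, e12_11,
        e21_00, e21_01, e21_10, e21_11, h00, h01, h10, h11] <;> grind
    rw [this]
    exact H.mul_mem (H.mul_mem h1 (hup _)) (hlo _)
  rw [eq_top_iff]
  intro g _
  obtain ⟨h, hh, a, b, c, d, h00, h01, h10, h11⟩ := hcong g
  have hdg := sdet g
  have hdh := sdet h
  have hk : g * h⁻¹ ∈ H := by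
    apply hker (g * h⁻¹) (g.1 0 0 * d - g.1 0 1 * c) (-g.1 0 0 * b + g.1 0 1 * a)
      (g.1 1 0 * d - g.1 1 1 * c) (-g.1 1 0 * b + g.1 1 1 * a) <;>
    simp only [sm00, sm01, sm10, sm11, si00, si01, si10, si11, h00, h01, h10, h11]
    · linear_combination hdg
    · ring
    · ring
    · linear_combination hdg
  have := H.mul_mem hk hh
  rwa [inv_mul_cancel_right] at this
end lifting

section absmain
set_option linter.unusedSimpArgs false
variable {O : Type*} [CommRing O]

/-- reduction of `SL₂` modulo an ideal -/
abbrev redJ (J : Ideal O) : SL(2, O) →* SL(2, O ⧸ J) :=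
  Matrix.SpecialLinearGroup.map (Ideal.Quotient.mk J)

lemma redJ_apply (J : Ideal O) (g : SL(2, O)) (i j : Fin 2) :
    (redJ J g).1 i j = Ideal.Quotient.mk J (g.1 i j) := rfl

lemma redJ_e12 (J : Ideal O) (x : O) : redJ J (e12 x) = e12 (Ideal.Quotient.mk J x) := by
  apply sext <;> simp only [redJ_apply, e12_00, e12_01, e12_10, e12_11, map_one, map_zero]

lemma redJ_e21 (J : Ideal O) (x : O) : redJ J (e21 x) = e21 (Ideal.Quotient.mk J x) := by
  apply sext <;> simp only [redJ_apply, e21_00, e21_01, e21_10, e21_11, map_one, map_zero]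

lemma redJ_neg (J : Ideal O) (x : SL(2, O)) : redJ J (-x) = - redJ J x := by
  apply sext <;> simp only [redJ_apply, sn00, sn01, sn10, sn11, map_neg]

lemma unr_pow (p : ℕ) (hp : p.Prime) (P : Ideal O) (hpP : (p : O) ∈ P)
    (k : ℕ) (hk : 1 ≤ k) (hfr : ∀ x : O, x ^ (p ^ k) - x ∈ Ideal.span {(p : O)}) (d : ℕ) :
    ∀ x ∈ P ^ d, ∃ y, x - (p : O) ^ d * y ∈ P ^ (d + 1) := by
  have h1 : ∀ x ∈ P, ∃ y, x - (p : O) * y ∈ P ^ 2 := by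
    intro x hx
    obtain ⟨y, hy⟩ := Ideal.mem_span_singleton.1 (hfr x)
    refine ⟨-y, ?_⟩
    have : x - (p : O) * (-y) = x ^ (p ^ k) := by linear_combination -hy
    rw [this]
    have h2 : 2 ≤ p ^ k := hp.two_le.trans (Nat.le_self_pow (by omega) p)
    exact Ideal.pow_le_pow_right h2 (Ideal.pow_mem_pow hx _)
  induction d with
  | zero => intro x _; exact ⟨x, by simp⟩
  | succ d ih =>
    intro x hx
    rw [pow_succ] at hx
    induction hx using Submodule.mul_induction_on' with
    | mem_mul_mem a ha b hb =>
      obtain ⟨y, hy⟩ := ih a ha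
      obtain ⟨z, hz⟩ := h1 b hb
      refine ⟨y * z, ?_⟩
      have e : a * b - (p : O) ^ (d + 1) * (y * z) =
          (a - (p : O) ^ d * y) * b + y * ((p : O) ^ d * (b - p * z)) := by ring
      rw [e]
      refine Ideal.add_mem _ ?_ (Ideal.mul_mem_left _ _ ?_)
      · rw [pow_succ P (d + 1)]; exact Ideal.mul_mem_mul hy hb
      · have : P ^ (d + 1 + 1) = P ^ d * P ^ 2 := by rw [← pow_add]
        rw [this]; exact Ideal.mul_mem_mul (Ideal.pow_mem_pow hpP d) hz
    | add a _ b _ ha hb =>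
      obtain ⟨y, hy⟩ := ha
      obtain ⟨z, hz⟩ := hb
      refine ⟨y + z, ?_⟩
      have e : a + b - (p : O) ^ (d + 1) * (y + z) =
          (a - (p : O) ^ (d + 1) * y) + (b - (p : O) ^ (d + 1) * z) := by ring
      rw [e]
      exact Ideal.add_mem _ hy hz

lemma unit_mod (P : Ideal O) (hP : P.IsMaximal) (d : ℕ) (x : O) (hx : x ∉ P) :
    IsUnit (Ideal.Quotient.mk (P ^ d) x) := by
  have h1 : Ideal.span {x} ⊔ P = ⊤ := by
    by_contra h
    have := hP.eq_of_le h le_sup_right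
    apply hx
    rw [this]
    exact (le_sup_left : Ideal.span {x} ≤ _) (Ideal.mem_span_singleton_self x)
  have h2 := Ideal.sup_pow_eq_top (n := d) h1
  rw [Ideal.eq_top_iff_one, Ideal.mem_span_singleton_sup] at h2
  obtain ⟨a, b, hb, hab⟩ := h2
  refine IsUnit.of_mul_eq_one_right (Ideal.Quotient.mk (P ^ d) a) ?_
  rw [← map_mul, ← map_one (Ideal.Quotient.mk (P ^ d)), Ideal.Quotient.eq]
  have : a * x - 1 = -b := by linear_combination hab
  rw [this]
  exact neg_mem hb

lemma local_mod (P : Ideal O) (hP : P.IsMaximal) (d : ℕ) (hd : 1 ≤ d) : IsLocalRing (O ⧸ P ^ d) := by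
  have hne : P ^ d ≠ ⊤ := fun h => hP.ne_top (top_le_iff.1 (h ▸ Ideal.pow_le_self (by omega)))
  have : Nontrivial (O ⧸ P ^ d) := Ideal.Quotient.nontrivial_iff.2 hne
  have key : ∀ x : O, Ideal.Quotient.mk (P ^ d) x ∈ nonunits _ ↔ x ∈ P := by
    intro x
    constructor
    · intro h
      by_contra hx
      exact h (unit_mod P hP d x hx)
    · intro hx hu
      have hnil : IsNilpotent (Ideal.Quotient.mk (P ^ d) x) :=
        ⟨d, by rw [← map_pow, Ideal.Quotient.eq_zero_iff_mem]; exact Ideal.pow_mem_pow hx d⟩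
      exact hu.not_isNilpotent hnil
  refine IsLocalRing.of_nonunits_add ?_
  intro a b ha hb
  obtain ⟨a, rfl⟩ := Ideal.Quotient.mk_surjective a
  obtain ⟨b, rfl⟩ := Ideal.Quotient.mk_surjective b
  rw [← map_add, key]
  exact P.add_mem ((key a).1 ha) ((key b).1 hb)

lemma base_case (lam : O) (hgen : Subring.closure {lam} = ⊤) (p : ℕ) (hp : p.Prime) (hpodd : Odd p)
    (P : Ideal O) (hP : P.IsMaximal) (hpP : (p : O) ∈ P)
    (k : ℕ) (hk : 1 ≤ k) (hfr : ∀ x : O, x ^ (p ^ k) - x ∈ Ideal.span {(p : O)})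
    (hμ : 2 + lam ∉ P) (h2 : (2 : O) ∉ P) (hex : ¬ (p = 3 ∧ (2 + lam) ^ 2 + 1 ∈ P))
    (D : Subgroup SL(2, O)) (hT : e12 (2 + lam) ∈ D) (hU : -e21 (-1) ∈ D) :
    D.map (redJ P) = ⊤ := by
  letI : Field (O ⧸ P) := Ideal.Quotient.field P
  haveI : Fact p.Prime := ⟨hp⟩
  have hp0 : (p : O ⧸ P) = 0 := by
    rw [← map_natCast (Ideal.Quotient.mk P), Ideal.Quotient.eq_zero_iff_mem]; exact hpP
  haveI : CharP (O ⧸ P) p := (CharP.charP_iff_prime_eq_zero hp).2 hp0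
  have hpk : 1 < p ^ k := Nat.one_lt_pow (by omega) hp.one_lt
  haveI : Finite (O ⧸ P) := by
    have hne : (Polynomial.X ^ (p ^ k) - Polynomial.X : Polynomial (O ⧸ P)) ≠ 0 :=
      FiniteField.X_pow_card_sub_X_ne_zero _ hpk
    have hfin := Polynomial.finite_setOf_isRoot hne
    apply Set.finite_univ_iff.1
    apply hfin.subset
    intro x _
    obtain ⟨x, rfl⟩ := Ideal.Quotient.mk_surjective x
    simp only [Set.mem_setOf_eq, Polynomial.IsRoot.def, Polynomial.eval_sub, Polynomial.eval_pow, Polynomial.eval_X]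
    rw [← map_pow, ← map_sub, Ideal.Quotient.eq_zero_iff_mem]
    exact (Ideal.span_singleton_le_iff_mem P).2 hpP (hfr x)
  have h2F : (2 : O ⧸ P) ≠ 0 := by
    rw [← map_ofNat (Ideal.Quotient.mk P) 2, Ne, Ideal.Quotient.eq_zero_iff_mem]; exact h2
  have hTH : e12 (Ideal.Quotient.mk P (2 + lam)) ∈ D.map (redJ P) := ⟨_, hT, redJ_e12 _ _⟩
  have hUH : -e21 (-1) ∈ D.map (redJ P) := ⟨_, hU, by rw [redJ_neg, redJ_e21, map_neg, map_one]⟩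
  have h2lo : (-2 : O ⧸ P) ∈ loY (D.map (redJ P)) := by
    show e21 (-2) ∈ D.map (redJ P)
    have : e21 (-2 : O ⧸ P) = -e21 (-1) * -e21 (-1) := by
      apply sext <;> simp only [sm00, sm01, sm10, sm11, sn00, sn01, sn10, sn11, e21_00, e21_01, e21_10, e21_11] <;> ring
    rw [this]; exact mul_mem hUH hUH
  obtain ⟨m, hm⟩ := hpodd
  have h1lo : (-1 : O ⧸ P) ∈ loY (D.map (redJ P)) := by
    have h := (loY (D.map (redJ P))).nsmul_mem h2lo (m + 1)
    have e : (m + 1) • (-2 : O ⧸ P) = -1 := by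
      rw [hm] at hp0
      push_cast at hp0
      rw [nsmul_eq_mul]; push_cast; linear_combination -hp0
    rwa [e] at h
  have h1 : e21 (1 : O ⧸ P) ∈ D.map (redJ P) := by
    have := (loY (D.map (redJ P))).neg_mem h1lo
    rw [neg_neg] at this; exact this
  have hneg : (-1 : SL(2, O ⧸ P)) ∈ D.map (redJ P) := by
    have : (-1 : SL(2, O ⧸ P)) = -e21 (-1) * e21 1 := by
      rw [neg_mul, ← e21_add, neg_add_cancel, e21_zero]
    rw [this]; exact mul_mem hUH h1
  refine field_full p hneg h2F (μ := Ideal.Quotient.mk P (2 + lam)) ?_ hTH h1 ?_ ?_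
  · rw [Ne, Ideal.Quotient.eq_zero_iff_mem]; exact hμ
  · rw [eq_top_iff]
    intro x _
    obtain ⟨x, rfl⟩ := Ideal.Quotient.mk_surjective x
    have hx : x ∈ Subring.closure {lam} := by rw [hgen]; trivial
    have hle : Subring.closure {lam} ≤
        (Subring.closure {Ideal.Quotient.mk P (2 + lam)}).comap (Ideal.Quotient.mk P) := by
      rw [Subring.closure_le, Set.singleton_subset_iff]
      show Ideal.Quotient.mk P lam ∈ Subring.closure {Ideal.Quotient.mk P (2 + lam)}
      have e : Ideal.Quotient.mk P lam = Ideal.Quotient.mk P (2 + lam) - (2 : ℕ) := by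
        rw [map_add, map_ofNat]; push_cast; ring
      rw [e]
      exact sub_mem (Subring.subset_closure rfl) (natCast_mem _ 2)
    exact hle hx
  · rintro ⟨h3, hsq⟩
    apply hex
    refine ⟨h3, ?_⟩
    rw [← Ideal.Quotient.eq_zero_iff_mem, map_add, map_pow, map_one, hsq]; ring

lemma step_case (lam : O) (p : ℕ) (P : Ideal O) (hP : P.IsMaximal) (hpP : (p : O) ∈ P)
    (d : ℕ) (hd : 1 ≤ d) (hunr : ∀ x ∈ P ^ d, ∃ y, x - (p : O) ^ d * y ∈ P ^ (d + 1))
    (hμ : 2 + lam ∉ P) (h2 : (2 : O) ∉ P)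
    (D : Subgroup SL(2, O)) (hT : e12 (2 + lam) ∈ D)
    (ih : D.map (redJ (P ^ d)) = ⊤) :
    D.map (redJ (P ^ (d + 1))) = ⊤ := by
  haveI := local_mod P hP (d + 1) (by omega)
  have hcmp : ∀ (g : SL(2, O ⧸ P ^ (d + 1))) (δ : SL(2, O)) (i j : Fin 2),
      Ideal.Quotient.mk (P ^ d) (δ.1 i j) = Ideal.Quotient.factorPow P (Nat.le_succ d) (g.1 i j) →
      ∃ a, (redJ (P ^ (d + 1)) δ).1 i j = g.1 i j + Ideal.Quotient.mk (P ^ (d + 1)) ((p : O) ^ d) * a := by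
    intro g δ i j h
    obtain ⟨x, hx⟩ := Ideal.Quotient.mk_surjective (g.1 i j)
    rw [← hx] at h ⊢
    have h : Ideal.Quotient.mk (P ^ d) (δ.1 i j) = Ideal.Quotient.mk (P ^ d) x := h
    rw [Ideal.Quotient.eq] at h
    obtain ⟨y, hy⟩ := hunr _ h
    refine ⟨Ideal.Quotient.mk _ y, ?_⟩
    rw [redJ_apply, ← map_mul, ← map_add, Ideal.Quotient.eq]
    have : δ.1 i j - (x + (p : O) ^ d * y) = δ.1 i j - x - (p : O) ^ d * y := by ring
    rw [this]; exact hy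
  refine lift_full (D.map (redJ (P ^ (d + 1)))) (Ideal.Quotient.mk _ ((p : O) ^ d))
    (Ideal.Quotient.mk _ (2 + lam)) ?_ ?_ (unit_mod P hP _ _ hμ) ?_ ?_ ?_
  · rw [← map_mul, Ideal.Quotient.eq_zero_iff_mem, ← pow_add]
    exact Ideal.pow_le_pow_right (by omega) (Ideal.pow_mem_pow hpP _)
  · intro m hm
    obtain ⟨m, rfl⟩ := Ideal.Quotient.mk_surjective m
    rw [← map_mul, Ideal.Quotient.eq_zero_iff_mem, pow_succ]
    have : m ∈ P := by
      by_contra h; exact hm (unit_mod P hP _ _ h)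
    exact Ideal.mul_mem_mul (Ideal.pow_mem_pow hpP d) this
  · have := unit_mod P hP (d + 1) 2 h2
    rwa [map_ofNat] at this
  · intro g
    have hg : Matrix.SpecialLinearGroup.map (Ideal.Quotient.factorPow P (Nat.le_succ d)) g ∈ D.map (redJ (P ^ d)) := by
      rw [ih]; trivial
    obtain ⟨δ, hδ, hδg⟩ := hg
    have hent : ∀ i j, Ideal.Quotient.mk (P ^ d) (δ.1 i j) =
        Ideal.Quotient.factorPow P (Nat.le_succ d) (g.1 i j) := by
      intro i j
      exact congrArg (fun z : SL(2, O ⧸ P ^ d) => z.1 i j) hδg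
    obtain ⟨a, ha⟩ := hcmp g δ 0 0 (hent 0 0)
    obtain ⟨b, hb⟩ := hcmp g δ 0 1 (hent 0 1)
    obtain ⟨c, hc⟩ := hcmp g δ 1 0 (hent 1 0)
    obtain ⟨e, he⟩ := hcmp g δ 1 1 (hent 1 1)
    exact ⟨redJ _ δ, ⟨δ, hδ, rfl⟩, a, b, c, e, ha, hb, hc, he⟩
  · refine ⟨e12 ((p : O) ^ d * (2 + lam)), ?_, by rw [redJ_e12, map_mul]⟩
    have := (upX D).nsmul_mem hT (p ^ d)
    rw [nsmul_eq_mul] at this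
    push_cast at this
    exact this

theorem abs_main (lam : O) (hgen : Subring.closure {lam} = ⊤) (p : ℕ) (hp : p.Prime) (hpodd : Odd p)
    (P : Ideal O) (hP : P.IsMaximal) (hpP : (p : O) ∈ P)
    (k : ℕ) (hk : 1 ≤ k) (hfr : ∀ x : O, x ^ (p ^ k) - x ∈ Ideal.span {(p : O)})
    (hμ : 2 + lam ∉ P) (hex : ¬ (p = 3 ∧ (2 + lam) ^ 2 + 1 ∈ P))
    (D : Subgroup SL(2, O)) (hT : e12 (2 + lam) ∈ D) (hU : -e21 (-1) ∈ D) (d : ℕ) (hd : 1 ≤ d) :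
    D.map (redJ (P ^ d)) = ⊤ := by
  have h2 : (2 : O) ∉ P := by
    intro h
    obtain ⟨m, hm⟩ := hpodd
    rw [hm] at hpP
    push_cast at hpP
    apply hP.ne_top
    rw [Ideal.eq_top_iff_one]
    exact (Ideal.add_mem_iff_right P (P.mul_mem_right _ h)).1 hpP
  have hbase : ∀ J : Ideal O, J = P → D.map (redJ J) = ⊤ := by
    rintro J rfl
    exact base_case lam hgen p hp hpodd J hP hpP k hk hfr hμ h2 hex D hT hU
  induction d, hd using Nat.le_induction with
  | base => exact hbase _ (pow_one P)
  | succ d hd ih =>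
    exact step_case lam p P hP hpP d hd (unr_pow p hp P hpP k hk hfr d) hμ h2 D hT ih
end absmain

section numbertheory
open Polynomial

/-- the element `ζ^m + ζ^(-m)` of `O` -/
def cO (ζ : ℂ) (m : ℕ) : Oring ζ := (dickson 1 (1 : Oring ζ) m).eval (lamO ζ)

lemma cO_coe (ζ : ℂ) (hζ0 : ζ ≠ 0) (m : ℕ) : (cO ζ m : ℂ) = ζ ^ m + ζ⁻¹ ^ m := by
  rw [← dickson_one_one_eval_add_inv ζ ζ⁻¹ (mul_inv_cancel₀ hζ0) m]
  have h1 : dickson 1 (1 : ℂ) m = (dickson 1 (1 : Oring ζ) m).map (algebraMap (Oring ζ) ℂ) := by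
    rw [map_dickson, map_one]
  rw [h1]
  exact (Polynomial.eval_map_apply (algebraMap (Oring ζ) ℂ) (lamO ζ)).symm

lemma O_closure (ζ : ℂ) : Subring.closure {lamO ζ} = ⊤ := by
  rw [eq_top_iff]
  rintro ⟨x, hx⟩ _
  induction hx using Algebra.adjoin_induction with
  | mem x hx =>
    have hx := Set.mem_singleton_iff.1 hx
    subst hx
    exact Subring.subset_closure rfl
  | algebraMap r =>
    exact intCast_mem (Subring.closure {lamO ζ}) r
  | add x y hx hy h1 h2 => exact add_mem (h1 trivial) (h2 trivial)
  | mul x y hx hy h1 h2 => exact mul_mem (h1 trivial) (h2 trivial)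

lemma dickson_pp (B : Type*) [CommRing B] (p : ℕ) [Fact p.Prime] [CharP B p] (k : ℕ) :
    dickson 1 (1 : B) (p ^ k) = X ^ (p ^ k) := by
  induction k with
  | zero => simp
  | succ k ih =>
    rw [pow_succ, dickson_one_one_mul, ih, dickson_one_one_charP, X_pow_comp, ← pow_mul, mul_comm]

lemma frob_O (n : ℕ) (hn : 3 ≤ n) (ζ : ℂ) (hζ : IsPrimitiveRoot ζ n) (p : ℕ) (hp : p.Prime) (hpn : ¬ p ∣ n)
    (P : Ideal (Oring ζ)) (hP : P ≠ ⊤) (hpP : (p : Oring ζ) ∈ P) :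
    ∃ k, 1 ≤ k ∧ ∀ x : Oring ζ, x ^ (p ^ k) - x ∈ Ideal.span {(p : Oring ζ)} := by
  have hζ0 : ζ ≠ 0 := hζ.ne_zero (by omega)
  refine ⟨n.totient, Nat.totient_pos.2 (by omega), ?_⟩
  set k := n.totient with hk
  have : Fact p.Prime := ⟨hp⟩
  set J := Ideal.span {(p : Oring ζ)} with hJ
  have hJne : J ≠ ⊤ := by
    intro h
    apply hP
    rw [eq_top_iff, ← h, hJ, Ideal.span_singleton_le_iff_mem]; exact hpP
  have : Nontrivial (Oring ζ ⧸ J) := Ideal.Quotient.nontrivial_iff.2 hJne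
  have : CharP (Oring ζ ⧸ J) p := (CharP.charP_iff_prime_eq_zero hp).2 (by
    rw [← map_natCast (Ideal.Quotient.mk J), Ideal.Quotient.eq_zero_iff_mem]
    exact Ideal.mem_span_singleton_self _)
  have hmod : p ^ k ≡ 1 [MOD n] := Nat.ModEq.pow_totient ((Nat.Prime.coprime_iff_not_dvd hp).2 hpn)
  have hzp : ζ ^ (p ^ k) = ζ := by
    have := pow_eq_pow_of_modEq hmod hζ.pow_eq_one
    rw [this, pow_one]
  have hcl : cO ζ (p ^ k) = lamO ζ := by
    apply Subtype.ext
    rw [cO_coe ζ hζ0, inv_pow, hzp]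
    rfl
  have hlam : Ideal.Quotient.mk J (lamO ζ) ^ (p ^ k) = Ideal.Quotient.mk J (lamO ζ) := by
    have h1 : (dickson 1 (1 : Oring ζ ⧸ J) (p ^ k)).eval (Ideal.Quotient.mk J (lamO ζ)) =
        Ideal.Quotient.mk J (lamO ζ) ^ (p ^ k) := by
      rw [dickson_pp, eval_pow, eval_X]
    rw [← h1, ← map_one (Ideal.Quotient.mk J), ← map_dickson, Polynomial.eval_map_apply]
    exact congrArg _ hcl
  let f : Oring ζ →+* Oring ζ ⧸ J := (iterateFrobenius (Oring ζ ⧸ J) p k).comp (Ideal.Quotient.mk J)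
  have hf : ∀ x, f x = Ideal.Quotient.mk J x ^ (p ^ k) := fun x => by
    show iterateFrobenius (Oring ζ ⧸ J) p k _ = _
    rw [iterateFrobenius_def]
  intro x
  have hx : x ∈ Subring.closure {lamO ζ} := by rw [O_closure]; trivial
  have hle : Subring.closure {lamO ζ} ≤ f.eqLocus (Ideal.Quotient.mk J) := by
    rw [Subring.closure_le, Set.singleton_subset_iff]
    show f (lamO ζ) = _
    rw [hf, hlam]
  have h2 : f x = Ideal.Quotient.mk J x := hle hx
  rw [hf, ← map_pow] at h2
  exact Ideal.Quotient.eq.1 h2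

lemma two_sub_c (n : ℕ) (hn : 3 ≤ n) (ζ : ℂ) (hζ : IsPrimitiveRoot ζ n) (p : ℕ) (hp : p.Prime) (hpn : ¬ p ∣ n)
    (P : Ideal (Oring ζ)) (hP : P.IsMaximal) (hpP : (p : Oring ζ) ∈ P) (j : ℕ) (hj : ¬ n ∣ j) :
    2 - cO ζ j ∉ P := by
  have hζ0 : ζ ≠ 0 := hζ.ne_zero (by omega)
  intro hmem
  have hcj : cO ζ j = cO ζ (j % n) := by
    apply Subtype.ext
    rw [cO_coe ζ hζ0, cO_coe ζ hζ0, inv_pow, inv_pow]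
    rw [pow_eq_pow_of_modEq (Nat.mod_modEq j n).symm hζ.pow_eq_one]
  rw [hcj] at hmem
  have hj1 : j % n ≠ 0 := fun h => hj (Nat.dvd_of_mod_eq_zero h)
  have hj2 : j % n < n := Nat.mod_lt _ (by omega)
  obtain ⟨m, rfl⟩ : ∃ m, n = m + 1 := ⟨n - 1, by omega⟩
  have hprod : ∏ i ∈ Finset.range m, (2 - cO ζ (i + 1)) = ((m + 1 : ℕ) : Oring ζ) ^ 2 := by
    apply Subtype.ext
    push_cast
    have e1 := hζ.prod_one_sub_pow_eq_order
    have e2 := hζ.inv.prod_one_sub_pow_eq_order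
    rw [sq]
    nth_rewrite 1 [← e1]
    rw [← e2, ← Finset.prod_mul_distrib]
    apply Finset.prod_congr rfl
    intro i _
    have : ζ ^ (i + 1) * ζ⁻¹ ^ (i + 1) = 1 := by rw [← mul_pow, mul_inv_cancel₀ hζ0, one_pow]
    have h2 := cO_coe ζ hζ0 (i + 1)
    have h22 : ((2 : Oring ζ) : ℂ) = 2 := rfl
    rw [h2, h22]
    linear_combination -this
  have hn2 : ((m + 1 : ℕ) : Oring ζ) ^ 2 ∈ P := by
    rw [← hprod]
    have hin : j % (m + 1) - 1 ∈ Finset.range m := by rw [Finset.mem_range]; omega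
    refine P.mem_of_dvd (Finset.dvd_prod_of_mem _ hin) ?_
    have : j % (m + 1) - 1 + 1 = j % (m + 1) := by omega
    rw [this]; exact hmem
  have hn1 : ((m + 1 : ℕ) : Oring ζ) ∈ P := hP.isPrime.mem_of_pow_mem 2 hn2
  have hcop : Nat.Coprime p (m + 1) := (Nat.Prime.coprime_iff_not_dvd hp).2 hpn
  have hb := Nat.gcd_eq_gcd_ab p (m + 1)
  rw [hcop.gcd_eq_one] at hb
  have hb' := congrArg (fun z : ℤ => (z : Oring ζ)) hb
  simp only [Int.cast_add, Int.cast_mul, Int.cast_natCast, Int.cast_one, Nat.cast_one] at hb'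
  apply hP.ne_top
  rw [Ideal.eq_top_iff_one, hb']
  exact P.add_mem (P.mul_mem_right _ hpP) (P.mul_mem_right _ hn1)

lemma cO_two (ζ : ℂ) (hζ0 : ζ ≠ 0) : cO ζ 2 = lamO ζ ^ 2 - 2 := by
  apply Subtype.ext
  rw [cO_coe ζ hζ0]
  show _ = (ζ + ζ⁻¹) ^ 2 - 2
  field_simp
  ring

lemma cO_five (ζ : ℂ) (hζ0 : ζ ≠ 0) : cO ζ 5 - 2 = (lamO ζ - 2) * (lamO ζ ^ 2 + lamO ζ - 1) ^ 2 := by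
  apply Subtype.ext
  show (cO ζ 5 : ℂ) - 2 = ((ζ + ζ⁻¹) - 2) * ((ζ + ζ⁻¹) ^ 2 + (ζ + ζ⁻¹) - 1) ^ 2
  rw [cO_coe ζ hζ0]
  field_simp
  ring

end numbertheory

theorem surjective_mod_prime_power_unramified
    (n : ℕ) (hn : 3 ≤ n) (ζ : ℂ) (hζ : IsPrimitiveRoot ζ n)
    (p : ℕ) (hp : p.Prime) (hpodd : Odd p) (hpn : ¬ p ∣ n)
    (h35 : ¬(p = 3 ∧ n = 5))
    (𝔭 : Ideal (Oring ζ)) (h𝔭 : 𝔭.IsMaximal) (hp𝔭 : (p : Oring ζ) ∈ 𝔭)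
    (d : ℕ) (hd : 1 ≤ d) :
    (Delta ζ).map (SLred ζ (𝔭 ^ d)) = ⊤ := by
  have hζ0 : ζ ≠ 0 := hζ.ne_zero (by omega)
  obtain ⟨k, hk, hfr⟩ := frob_O n hn ζ hζ p hp hpn 𝔭 h𝔭.ne_top hp𝔭
  have htwo := two_sub_c n hn ζ hζ p hp hpn 𝔭 h𝔭 hp𝔭
  refine abs_main (lamO ζ) (O_closure ζ) p hp hpodd 𝔭 h𝔭 hp𝔭 k hk hfr ?_ ?_ (Delta ζ) ?_ ?_ d hd
  · intro h
    apply htwo 2 (fun h2 => by have := Nat.le_of_dvd (by norm_num) h2; omega)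
    have : 2 - cO ζ 2 = (2 - lamO ζ) * (2 + lamO ζ) := by rw [cO_two ζ hζ0]; ring
    rw [this]
    exact 𝔭.mul_mem_left _ h
  · rintro ⟨h3, hsq⟩
    have hn5 : ¬ n ∣ 5 := by
      intro h
      rcases (Nat.dvd_prime Nat.prime_five).1 h with h | h
      · omega
      · exact h35 ⟨h3, h⟩
    apply htwo 5 hn5
    have e1 : lamO ζ ^ 2 + lamO ζ - 1 = (2 + lamO ζ) ^ 2 + 1 - (p : Oring ζ) * (lamO ζ + 2) := by
      rw [h3]; push_cast; ring
    have h4 : lamO ζ ^ 2 + lamO ζ - 1 ∈ 𝔭 := by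
      rw [e1]; exact 𝔭.sub_mem hsq (𝔭.mul_mem_right _ hp𝔭)
    have e2 : 2 - cO ζ 5 = -((lamO ζ - 2) * (lamO ζ ^ 2 + lamO ζ - 1)) * (lamO ζ ^ 2 + lamO ζ - 1) := by
      linear_combination -(cO_five ζ hζ0)
    rw [e2]
    exact 𝔭.mul_mem_left _ h4
  · exact Subgroup.subset_closure (Or.inl rfl)
  · have : -e21 (-1) = Umat ζ := by
      apply sext <;> simp only [sn00, sn01, sn10, sn11, e21_00, e21_01, e21_10, e21_11] <;> simp [Umat]
    rw [this]
    exact Subgroup.subset_closure (Or.inr rfl)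

end
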